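/- arXiv:1409.8223 — 2 statements merged into one kernel-verified Lean document; each statement's English description precedes it below -/
import Mathlib

section
/- Let f : ℝ² → ℝ be a regular function (i.e., there exist polynomials p, q ∈ ℝ[x,y] with q(x) ≠ 0 for every x ∈ ℝ² and f(x) = p(x)/q(x) for all x ∈ ℝ²) which is non-negative on ℝ². Then there exist m ∈ ℕ and regular functions f₁, …, f_m : ℝ² → ℝ (each f_i = p_i/q_i with q_i nowhere vanishing on ℝ²) such that f = f₁² + ⋯ + f_m² pointwise on ℝ². -/
open MvPolynomial

/-- A function `f : ℝ² → ℝ` is regular if it is globally a quotient of polynomials with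
nowhere-vanishing denominator. -/
def RegularR2 (f : (Fin 2 → ℝ) → ℝ) : Prop :=
  ∃ p q : MvPolynomial (Fin 2) ℝ, (∀ x : Fin 2 → ℝ, eval x q ≠ 0) ∧
    ∀ x : Fin 2 → ℝ, f x = eval x p / eval x q

open scoped Polynomial

namespace Polynomial.HilbertPlane

/-- `q` divides one plus a sum of squares. -/
def DvdOneAddSq {R : Type*} [CommRing R] (q : R) : Prop := ∃ s : R, IsSumSq s ∧ q ∣ 1 + s

theorem DvdOneAddSq.mul {R : Type*} [CommRing R] {p q : R} (hp : DvdOneAddSq p)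
    (hq : DvdOneAddSq q) : DvdOneAddSq (p * q) := by
  obtain ⟨s, hs, hps⟩ := hp
  obtain ⟨t, ht, hqt⟩ := hq
  refine ⟨s + t + s * t, (hs.add ht).add (hs.mul ht), ?_⟩
  have : 1 + (s + t + s * t) = (1 + s) * (1 + t) := by ring
  rw [this]; exact mul_dvd_mul hps hqt

theorem isSumSq_map {R S : Type*} [CommRing R] [CommRing S] (f : R →+* S) {s : R}
    (hs : IsSumSq s) : IsSumSq (f s) := by
  induction hs with
  | zero => simp [IsSumSq.zero]
  | sq_add a hs ih => rw [map_add, map_mul]; exact IsSumSq.sq_add _ ih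

theorem isSumSq_lift {R S : Type*} [CommRing R] [CommRing S] (f : R →+* S)
    (hf : Function.Surjective f) {s : S}
    (hs : IsSumSq s) : ∃ t : R, IsSumSq t ∧ f t = s := by
  induction hs with
  | zero => exact ⟨0, IsSumSq.zero, map_zero f⟩
  | sq_add a hs ih =>
    obtain ⟨t, ht, rfl⟩ := ih
    obtain ⟨b, rfl⟩ := hf a
    exact ⟨b * b + t, IsSumSq.sq_add _ ht, by simp⟩

theorem isSumSq_smul_sq {R : Type*} [CommRing R] (h : R) {s : R}
    (hs : IsSumSq s) : IsSumSq (h ^ 2 * s) := by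
  rw [pow_two]; exact (IsSumSq.mul_self h).mul hs

theorem isSumSq_iff_fin {R : Type*} [CommRing R] {s : R} :
    IsSumSq s ↔ ∃ (m : ℕ) (g : Fin m → R), s = ∑ i, g i ^ 2 := by
  constructor
  · intro hs
    induction hs with
    | zero => exact ⟨0, fun _ => 0, by simp⟩
    | sq_add a hs ih =>
      obtain ⟨m, g, rfl⟩ := ih
      exact ⟨m + 1, Fin.cons a g, by simp [Fin.sum_univ_succ, pow_two]⟩
  · rintro ⟨m, g, rfl⟩
    exact IsSumSq.sum_sq _ _

theorem nonneg_of_nonneg_off_finite (p : ℝ[X]) (S : Set ℝ) (hS : S.Finite)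
    (h : ∀ x, x ∉ S → 0 ≤ p.eval x) (x : ℝ) : 0 ≤ p.eval x := by
  have hd : Dense Sᶜ := hS.countable.dense_compl ℝ
  have hc : IsClosed {x : ℝ | 0 ≤ p.eval x} := isClosed_le continuous_const p.continuous
  have := hc.closure_subset_iff.2 (show Sᶜ ⊆ {x : ℝ | 0 ≤ p.eval x} from h)
  rw [hd.closure_eq] at this
  exact this (Set.mem_univ x)

/-- At a zero of a nonnegative polynomial the derivative vanishes. -/
theorem deriv_zero_of_nonneg (p : ℝ[X]) (h : ∀ x, 0 ≤ p.eval x) (c : ℝ) (hc : p.eval c = 0) :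
    p.derivative.eval c = 0 := by
  have : IsLocalMin (fun x => p.eval x) c := Filter.Eventually.of_forall (fun x => by
    simpa [hc] using h x)
  exact this.hasDerivAt_eq_zero (p.hasDerivAt c)

theorem exists_min (p : ℝ[X]) (h : ∀ x, 0 ≤ p.eval x) (hd : 0 < p.degree) :
    ∃ c, ∀ x, p.eval c ≤ p.eval x := by
  have ht := p.tendsto_norm_atTop hd (l := Filter.cocompact ℝ) (z := fun x => x) tendsto_norm_cocompact_atTop
  have h2 : Filter.Tendsto (fun x => p.eval x) (Filter.cocompact ℝ) Filter.atTop := by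
    refine ht.congr (fun x => ?_)
    rw [Real.norm_eq_abs, abs_of_nonneg (h x)]
  exact p.continuous.exists_forall_le h2

/-- A nonnegative real polynomial is a sum of squares. -/
theorem isSumSq_of_nonneg (p : ℝ[X]) (h : ∀ x, 0 ≤ p.eval x) : IsSumSq p := by
  induction hn : p.natDegree using Nat.strong_induction_on generalizing p with
  | _ n ih =>
    by_cases hd : 0 < p.degree
    · obtain ⟨c, hc⟩ := exists_min p h hd
      set q := p - C (p.eval c) with hq
      have hq0 : ∀ x, 0 ≤ q.eval x := fun x => by simp [hq, hc x]
      have hqc : q.eval c = 0 := by simp [hq]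
      have hqd := deriv_zero_of_nonneg q hq0 c hqc
      obtain ⟨a, ha⟩ := dvd_iff_isRoot.2 hqc
      have hac : a.eval c = 0 := by
        rw [ha] at hqd; simpa using hqd
      obtain ⟨b, hb⟩ := dvd_iff_isRoot.2 hac
      have hqb : q = (X - C c) * (X - C c) * b := by rw [ha, hb]; ring
      have hqne : q ≠ 0 := by
        intro h0
        have : p = C (p.eval c) := by rw [hq, sub_eq_zero] at h0; exact h0
        rw [this] at hd
        exact absurd hd (not_lt.2 degree_C_le)
      have hbne : b ≠ 0 := by rintro rfl; simp at hqb; exact hqne hqb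
      have hdeg : q.natDegree = b.natDegree + 2 := by
        rw [hqb, natDegree_mul (mul_ne_zero (X_sub_C_ne_zero c) (X_sub_C_ne_zero c)) hbne,
          natDegree_mul (X_sub_C_ne_zero c) (X_sub_C_ne_zero c), natDegree_X_sub_C]; ring
      have hqn : q.natDegree = n := by rw [hq, natDegree_sub_C, hn]
      have hb0 : ∀ x, 0 ≤ b.eval x := by
        apply nonneg_of_nonneg_off_finite b {c} (Set.finite_singleton c)
        intro x hx
        have h1 := hq0 x
        rw [hqb] at h1
        simp only [eval_mul, eval_sub, eval_X, eval_C] at h1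
        have : 0 < (x - c) * (x - c) := mul_self_pos.2 (sub_ne_zero.2 hx)
        exact nonneg_of_mul_nonneg_right h1 this
      have hbs := ih b.natDegree (by omega) b hb0 rfl
      have : p = (X - C c) * (X - C c) * b + C (√(p.eval c)) * C (√(p.eval c)) := by
        rw [← hqb, ← C_mul, Real.mul_self_sqrt (h c), hq]; ring
      rw [this]
      exact ((IsSumSq.mul_self _).mul hbs).add (IsSumSq.mul_self _)
    · have : p = C (p.coeff 0) := eq_C_of_degree_le_zero (not_lt.1 hd)
      have h0 : 0 ≤ p.coeff 0 := by rw [coeff_zero_eq_eval_zero]; exact h 0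
      rw [this, ← Real.mul_self_sqrt h0, C_mul]
      exact IsSumSq.mul_self _

/-- A real polynomial which is positive everywhere is a positive constant plus a sum of squares. -/
theorem exists_const_of_pos (p : ℝ[X]) (h : ∀ x, 0 < p.eval x) :
    ∃ m : ℝ, 0 < m ∧ IsSumSq (p - C m) := by
  by_cases hd : 0 < p.degree
  · obtain ⟨c, hc⟩ := exists_min p (fun x => (h x).le) hd
    exact ⟨p.eval c, h c, isSumSq_of_nonneg _ (fun x => by simp [hc x])⟩
  · have : p = C (p.coeff 0) := eq_C_of_degree_le_zero (not_lt.1 hd)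
    have h0 : 0 < p.coeff 0 := by rw [coeff_zero_eq_eval_zero]; exact h 0
    exact ⟨_, h0, by rw [← this]; simp [IsSumSq.zero]⟩

theorem pos_or_neg_of_no_root (p : ℝ[X]) (h : ∀ x, p.eval x ≠ 0) :
    (∀ x, 0 < p.eval x) ∨ (∀ x, 0 < (-p).eval x) := by
  rcases lt_or_gt_of_ne (h 0) with h0 | h0
  · right
    intro x
    by_contra hx
    simp only [eval_neg, not_lt, Left.neg_nonpos_iff] at hx
    obtain ⟨z, hz⟩ := mem_range_of_exists_le_of_exists_ge p.continuous ⟨0, h0.le⟩ ⟨x, hx⟩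
    exact h z hz
  · left
    intro x
    by_contra hx
    obtain ⟨z, hz⟩ := mem_range_of_exists_le_of_exists_ge p.continuous ⟨x, not_lt.1 hx⟩ ⟨0, h0.le⟩
    exact h z hz

theorem dvdOneAddSq_of_no_root (p : ℝ[X]) (h : ∀ x, p.eval x ≠ 0) : DvdOneAddSq p := by
  have key : ∀ p : ℝ[X], (∀ x, 0 < p.eval x) → DvdOneAddSq p := by
    intro p hp
    obtain ⟨m, hm, hs⟩ := exists_const_of_pos p hp
    refine ⟨C (√(m⁻¹)) * C (√(m⁻¹)) * (p - C m), (IsSumSq.mul_self _).mul hs, C (m⁻¹), ?_⟩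
    rw [← C_mul, Real.mul_self_sqrt (inv_nonneg.2 hm.le), mul_sub, ← C_mul,
      inv_mul_cancel₀ hm.ne', C_1]
    ring
  rcases pos_or_neg_of_no_root p h with h | h
  · exact key p h
  · obtain ⟨s, hs, hd⟩ := key _ h
    exact ⟨s, hs, (neg_dvd).1 hd⟩

section signs
variable {Ω : Type*} [Field Ω] [LinearOrder Ω] [IsStrictOrderedRing Ω] (ψ : ℝ[X] →+* Ω)

theorem psi_C_pos {m : ℝ} (hm : 0 < m) : 0 < ψ (C m) := by
  rw [← Real.mul_self_sqrt hm.le, C_mul, map_mul]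
  apply mul_self_pos.2
  have : (ψ.comp C) (√m) ≠ 0 := by
    rw [_root_.map_ne_zero]; exact (Real.sqrt_pos.2 hm).ne'
  exact this

theorem sign_agree (d : ℝ[X]) (hd : d ≠ 0) (hψ : Function.Injective ψ) (y : ℝ)
    (h : ∀ c, d.eval c = 0 → (ψ (C c) < ψ X ↔ c < y) ∧ c ≠ y) :
    (0 < d.eval y ∧ 0 < ψ d) ∨ (d.eval y < 0 ∧ ψ d < 0) := by
  induction hn : d.natDegree using Nat.strong_induction_on generalizing d with
  | _ n ih =>
    by_cases hr : ∃ c, d.eval c = 0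
    · obtain ⟨c, hc⟩ := hr
      obtain ⟨a, ha⟩ := dvd_iff_isRoot.2 hc
      have hane : a ≠ 0 := by rintro rfl; simp at ha; exact hd ha
      have hdeg : n = 1 + a.natDegree := by
        rw [← hn, ha, natDegree_mul (X_sub_C_ne_zero c) hane, natDegree_X_sub_C]
      have := ih a.natDegree (by omega) a hane (fun c' hc' => h c' (by rw [ha]; simp [hc'])) rfl
      have hcy := h c hc
      have hne : ψ (C c) ≠ ψ X := fun he => by
        have := hψ he
        exact (X_ne_C c) this.symm
      have e1 : d.eval y = (y - c) * a.eval y := by rw [ha]; simp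
      have e2 : ψ d = (ψ X - ψ (C c)) * ψ a := by rw [ha]; simp
      rw [e1, e2]
      rcases lt_or_gt_of_ne hne with h1 | h1
      · have h2 := hcy.1.1 h1
        have h1' := sub_pos.2 h1
        have h2' := sub_pos.2 h2
        rcases this with ⟨h3, h4⟩ | ⟨h3, h4⟩
        · exact Or.inl ⟨mul_pos h2' h3, mul_pos h1' h4⟩
        · exact Or.inr ⟨mul_neg_of_pos_of_neg h2' h3, mul_neg_of_pos_of_neg h1' h4⟩
      · have h2 : y < c := lt_of_le_of_ne (not_lt.1 (fun h => absurd (hcy.1.2 h) (not_lt.2 h1.le))) hcy.2.symm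
        have h1' := sub_neg.2 h1
        have h2' := sub_neg.2 h2
        rcases this with ⟨h3, h4⟩ | ⟨h3, h4⟩
        · exact Or.inr ⟨mul_neg_of_neg_of_pos h2' h3, mul_neg_of_neg_of_pos h1' h4⟩
        · exact Or.inl ⟨mul_pos_of_neg_of_neg h2' h3, mul_pos_of_neg_of_neg h1' h4⟩
    · have key : ∀ d : ℝ[X], (∀ x, 0 < d.eval x) → 0 < ψ d := by
        intro d h
        obtain ⟨m, hm, hs⟩ := exists_const_of_pos d h
        have h1 := (isSumSq_map ψ hs).nonneg
        have h2 := psi_C_pos ψ hm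
        rw [map_sub] at h1
        linarith
      push Not at hr
      rcases pos_or_neg_of_no_root d hr with h | h
      · exact Or.inl ⟨h y, key d h⟩
      · right
        have h1 := key _ h
        have h2 := h y
        simp only [eval_neg, map_neg] at h1 h2
        exact ⟨by linarith, by linarith⟩

theorem exists_sign_agree (hψ : Function.Injective ψ) {ι : Type*} [Fintype ι] (d : ι → ℝ[X])
    (hd : ∀ i, d i ≠ 0) :
    ∃ y : ℝ, ∀ i, (0 < (d i).eval y ∧ 0 < ψ (d i)) ∨ ((d i).eval y < 0 ∧ ψ (d i) < 0) := by
  classical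
  set S : Finset ℝ := (∏ i, d i).roots.toFinset with hS
  have hprod : (∏ i, d i) ≠ 0 := Finset.prod_ne_zero_iff.2 (fun i _ => hd i)
  have mono : ∀ a b : ℝ, ψ (C a) < ψ (C b) → a < b := by
    intro a b h
    by_contra hab
    rcases (not_lt.1 hab).lt_or_eq with h1 | h1
    · have := psi_C_pos ψ (sub_pos.2 h1)
      rw [C_sub, map_sub] at this
      linarith
    · rw [h1] at h; exact lt_irrefl _ h
  obtain ⟨y, hy1, hy2⟩ := Order.exists_between_finsets (S.filter (fun c => ψ (C c) < ψ X))
    (S.filter (fun c => ψ X < ψ (C c))) (by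
      intro a ha b hb
      simp only [Finset.mem_filter] at ha hb
      exact mono _ _ (ha.2.trans hb.2))
  refine ⟨y, fun i => sign_agree ψ (d i) (hd i) hψ y ?_⟩
  intro c hc
  have hcS : c ∈ S := by
    rw [hS, Multiset.mem_toFinset, mem_roots hprod, IsRoot, eval_prod]
    exact Finset.prod_eq_zero (Finset.mem_univ i) hc
  have hne : ψ (C c) ≠ ψ X := fun he => (X_ne_C c) (hψ he).symm
  rcases lt_or_gt_of_ne hne with h1 | h1
  · have := hy1 c (Finset.mem_filter.2 ⟨hcS, h1⟩)
    exact ⟨⟨fun _ => this, fun _ => h1⟩, this.ne⟩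
  · have := hy2 c (Finset.mem_filter.2 ⟨hcS, h1⟩)
    exact ⟨⟨fun h => absurd h (not_lt.2 h1.le), fun h => absurd h (not_lt.2 this.le)⟩, this.ne'⟩

end signs

end Polynomial.HilbertPlane

namespace Polynomial.HilbertPlane

theorem exists_matrix {B : Type*} [CommRing B] {c : B} (hc : IsSumSq c) :
    ∃ (ι : Type) (_ : Fintype ι) (_ : DecidableEq ι) (_ : Nonempty ι) (M : Matrix ι ι B),
      M.transpose * M = c • (1 : Matrix ι ι B) ∧ M * M.transpose = c • (1 : Matrix ι ι B) := by
  induction hc with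
  | zero => exact ⟨Unit, inferInstance, inferInstance, inferInstance, 0, by simp, by simp⟩
  | @sq_add b s hs ih =>
    obtain ⟨ι, _, _, _, M, h1, h2⟩ := ih
    refine ⟨ι ⊕ ι, inferInstance, inferInstance, inferInstance,
      Matrix.fromBlocks (b • 1) (-M.transpose) M (b • 1), ?_, ?_⟩
    · rw [Matrix.fromBlocks_transpose, Matrix.fromBlocks_multiply, ← Matrix.fromBlocks_one,
        Matrix.fromBlocks_smul]
      simp [h1, h2, smul_smul, add_smul, add_comm]
    · rw [Matrix.fromBlocks_transpose, Matrix.fromBlocks_multiply, ← Matrix.fromBlocks_one,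
        Matrix.fromBlocks_smul]
      simp [h1, h2, smul_smul, add_smul, add_comm]

/-- A negative definite subspace for `b ↦ T (b * b)` has at most half the dimension when `-1` is a
sum of squares. -/
theorem inertia {F B : Type*} [Field F] [LinearOrder F] [IsStrictOrderedRing F] [CommRing B]
    [Algebra F B] [FiniteDimensional F B] (T : B →ₗ[F] F) (h : IsSumSq (-1 : B))
    {κ : Type*} [Fintype κ] (w : (κ → F) →ₗ[F] B) (hw : ∀ c, c ≠ 0 → T (w c * w c) < 0) :
    2 * Fintype.card κ ≤ Module.finrank F B := by
  obtain ⟨ι, _, _, _, M, hM, -⟩ := exists_matrix h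
  have hw' : ∀ c, T (w c * w c) ≤ 0 := fun c => by
    by_cases hc : c = 0
    · simp [hc]
    · exact (hw c hc).le
  let Φ : ((ι → κ → F) × (ι → κ → F)) →ₗ[F] (ι → B) :=
    { toFun := fun p i => w (p.1 i) + ∑ j, M i j * w (p.2 j)
      map_add' := by
        intro p q; ext i
        simp only [Prod.fst_add, Prod.snd_add, Pi.add_apply, map_add, mul_add, Finset.sum_add_distrib]
        ring
      map_smul' := by
        intro r p; ext i
        simp [Finset.smul_sum] }
  have hΦ : Function.Injective Φ := by
    rw [← LinearMap.ker_eq_bot, LinearMap.ker_eq_bot']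
    rintro ⟨c, c'⟩ h0
    have h1 : ∀ i, w (c i) = -(M.mulVec (fun j => w (c' j))) i := by
      intro i
      have := congrFun h0 i
      exact eq_neg_of_add_eq_zero_left this
    set v : ι → B := fun j => w (c' j) with hv
    have h2 : ∑ i, w (c i) * w (c i) = - ∑ j, v j * v j := by
      have : ∑ i, w (c i) * w (c i) = (M.mulVec v) ⬝ᵥ (M.mulVec v) := by
        simp only [dotProduct]
        refine Finset.sum_congr rfl (fun i _ => ?_)
        rw [h1 i]; ring
      rw [this, Matrix.dotProduct_mulVec, ← Matrix.mulVec_transpose, Matrix.mulVec_mulVec, hM,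
        Matrix.smul_mulVec, Matrix.one_mulVec, smul_dotProduct]
      simp [dotProduct]
    have h3 : ∑ i, T (w (c i) * w (c i)) = - ∑ j, T (w (c' j) * w (c' j)) := by
      rw [← map_sum, h2, map_neg, map_sum]
    have h4 : ∑ i, T (w (c i) * w (c i)) ≤ 0 := Finset.sum_nonpos (fun i _ => hw' _)
    have h5 : ∑ i, T (w (c' i) * w (c' i)) ≤ 0 := Finset.sum_nonpos (fun i _ => hw' _)
    have h6 : ∑ i, T (w (c i) * w (c i)) = 0 := by linarith
    have h7 : ∑ i, T (w (c' i) * w (c' i)) = 0 := by linarith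
    rw [Finset.sum_eq_zero_iff_of_nonpos (fun i _ => hw' _)] at h6 h7
    have h8 : c = 0 := by
      ext1 i
      by_contra hne
      exact (hw _ hne).ne (h6 i (Finset.mem_univ i))
    have h9 : c' = 0 := by
      ext1 i
      by_contra hne
      exact (hw _ hne).ne (h7 i (Finset.mem_univ i))
    rw [h8, h9]; rfl
  have hle := LinearMap.finrank_le_finrank_of_injective hΦ
  rw [Module.finrank_prod, Module.finrank_pi_fintype, Module.finrank_pi_fintype] at hle
  rw [Module.finrank_pi_fintype] at hle
  simp only [Module.finrank_fintype_fun_eq_card, Module.finrank_self, Finset.sum_const,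
    Finset.card_univ, smul_eq_mul, mul_one] at hle
  have hpos : 0 < Fintype.card ι := Fintype.card_pos
  nlinarith

/-- The trace functional of `R[X]/(P)`, written as a residue. -/
noncomputable def rho {R : Type*} [CommRing R] (P : R[X]) : R[X] →ₗ[R] R :=
  (lcoeff R (P.natDegree - 1)).comp ((modByMonicHom P).comp (LinearMap.mulLeft R (derivative P)))

theorem rho_apply {R : Type*} [CommRing R] (P u : R[X]) :
    rho P u = ((derivative P * u) %ₘ P).coeff (P.natDegree - 1) := rfl

theorem rho_map {R S : Type*} [CommRing R] [CommRing S] [Nontrivial S] (φ : R →+* S) (P u : R[X])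
    (hP : P.Monic) : rho (P.map φ) (u.map φ) = φ (rho P u) := by
  rw [rho_apply, rho_apply, hP.natDegree_map, derivative_map, ← Polynomial.map_mul,
    ← map_modByMonic _ hP, coeff_map]

theorem coeff_mul_mod {F : Type*} [Field F] (l g v : F[X]) (hl : l.Monic) (hg : g.Monic) :
    ((g * v) %ₘ (l * g)).coeff ((l * g).natDegree - 1) = (v %ₘ l).coeff (l.natDegree - 1) := by
  have h1 : (g * v) %ₘ (l * g) = g * (v %ₘ l) := by
    refine (div_modByMonic_unique (v /ₘ l) _ (hl.mul hg) ⟨?_, ?_⟩).2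
    · conv_rhs => rw [← modByMonic_add_div v l]
      ring
    · rw [mul_comm l g, degree_mul, degree_mul]
      have := degree_modByMonic_lt v hl
      have hg0 : g.degree ≠ ⊥ := by rw [Ne, degree_eq_bot]; exact hg.ne_zero
      exact WithBot.add_lt_add_left hg0 this
  rw [h1]
  by_cases h0 : l.natDegree = 0
  · have : l = 1 := hl.natDegree_eq_zero.1 h0
    subst this
    simp
  · have h2 : (l * g).natDegree - 1 = g.natDegree + (l.natDegree - 1) := by
      rw [hl.natDegree_mul hg]; omega
    rw [h2, coeff_mul_add_eq_of_natDegree_le le_rfl]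
    · simp [hg]
    · have := natDegree_modByMonic_lt v hl (fun h => h0 (by simp [h]))
      omega

theorem rho_mul {F : Type*} [Field F] (l g u : F[X]) (hl : l.Monic) (hg : g.Monic) :
    rho (l * g) u = rho l u + rho g u := by
  have e : derivative (l * g) * u = g * (derivative l * u) + l * (derivative g * u) := by
    rw [derivative_mul]; ring
  rw [rho_apply, e, add_modByMonic, coeff_add, coeff_mul_mod l g _ hl hg, mul_comm l g,
    coeff_mul_mod g l _ hg hl]
  rfl

theorem rho_X_sub_C {F : Type*} [Field F] (a : F) (u : F[X]) :
    rho (X - C a) u = u.eval a := by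
  rw [rho_apply]; simp [modByMonic_X_sub_C_eq_C_eval]

theorem rho_prod {F : Type*} [Field F] (s : Multiset F) (g u : F[X]) (hg : g.Monic) :
    rho ((s.map (fun a => X - C a)).prod * g) u = (s.map (fun a => u.eval a)).sum + rho g u := by
  induction s using Multiset.induction_on with
  | empty => simp
  | cons a s ih =>
    rw [Multiset.map_cons, Multiset.prod_cons, mul_assoc, rho_mul _ _ _ (monic_X_sub_C a)
      ((monic_multiset_prod_of_monic _ _ (fun a _ => monic_X_sub_C a)).mul hg), ih, rho_X_sub_C,
      Multiset.map_cons, Multiset.sum_cons, add_assoc]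

/-- The functional `rho` descended to the quotient. -/
noncomputable def rhoQ {F : Type*} [Field F] (g : F[X]) (hg : g.Monic) : AdjoinRoot g →ₗ[F] F :=
  (rho g).comp (AdjoinRoot.modByMonicHom hg)

theorem rhoQ_mk {F : Type*} [Field F] (g : F[X]) (hg : g.Monic) (u : F[X]) :
    rhoQ g hg (AdjoinRoot.mk g u) = rho g u := by
  have : (derivative g * (u %ₘ g)) %ₘ g = (derivative g * u) %ₘ g := by
    have h := modByMonic_add_div u g
    have h2 : derivative g * u = derivative g * (u %ₘ g) + g * (derivative g * (u /ₘ g)) := by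
      conv_lhs => rw [← h]
      ring
    rw [h2, add_modByMonic, mul_comm g, mul_self_modByMonic hg, add_zero]
  simp only [rhoQ, LinearMap.comp_apply, AdjoinRoot.modByMonicHom_mk, rho_apply, this]

theorem isSumSq_neg_one_of_dvd {F : Type*} [Field F] (g : F[X]) (h : DvdOneAddSq g) :
    IsSumSq (-1 : AdjoinRoot g) := by
  obtain ⟨s, hs, hd⟩ := h
  have h1 : AdjoinRoot.mk g (1 + s) = 0 := AdjoinRoot.mk_eq_zero.2 hd
  rw [map_add, map_one] at h1
  rw [← eq_neg_of_add_eq_zero_right h1]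
  exact isSumSq_map (AdjoinRoot.mk g) hs

theorem dvd_of_isSumSq_neg_one {F : Type*} [Field F] (g : F[X])
    (h : IsSumSq (-1 : AdjoinRoot g)) : DvdOneAddSq g := by
  obtain ⟨t, ht, h1⟩ := isSumSq_lift (AdjoinRoot.mk g) AdjoinRoot.mk_surjective h
  refine ⟨t, ht, AdjoinRoot.mk_eq_zero.1 ?_⟩
  rw [map_add, map_one, h1]; ring

theorem inertia_poly {F : Type*} [Field F] [LinearOrder F] [IsStrictOrderedRing F] (g : F[X])
    (hg : g.Monic) (h : DvdOneAddSq g) (ε : F) {κ : Type*} [Fintype κ] (u : κ → F[X])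
    (hu : ∀ c : κ → F, c ≠ 0 → ε * rho g ((∑ i, c i • u i) * (∑ i, c i • u i)) < 0) :
    2 * Fintype.card κ ≤ g.natDegree := by
  have hfin : FiniteDimensional F (AdjoinRoot g) := (AdjoinRoot.powerBasis' hg).finite
  have hr : Module.finrank F (AdjoinRoot g) = g.natDegree := by
    rw [(AdjoinRoot.powerBasis' hg).finrank, AdjoinRoot.powerBasis'_dim]
  rw [← hr]
  refine inertia (ε • rhoQ g hg) (isSumSq_neg_one_of_dvd g h)
    (Fintype.linearCombination F (fun i => AdjoinRoot.mk g (u i))) ?_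
  intro c hc
  have : Fintype.linearCombination F (fun i => AdjoinRoot.mk g (u i)) c
      = AdjoinRoot.mk g (∑ i, c i • u i) := by
    rw [Fintype.linearCombination_apply, map_sum]
    simp [AdjoinRoot.smul_mk]
  rw [this, ← map_mul, LinearMap.smul_apply, rhoQ_mk]
  exact hu c hc

theorem rho_sq_expand {F : Type*} [Field F] (P : F[X]) {κ : Type*} [Fintype κ]
    (u : κ → F[X]) (ho : ∀ i j, i ≠ j → rho P (u i * u j) = 0) (c : κ → F) :
    rho P ((∑ i, c i • u i) * (∑ i, c i • u i)) = ∑ i, c i * c i * rho P (u i * u i) := by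
  rw [Finset.sum_mul_sum, map_sum]
  refine Finset.sum_congr rfl (fun i _ => ?_)
  rw [map_sum, Finset.sum_eq_single i]
  · rw [smul_mul_smul_comm, map_smul, smul_eq_mul]
  · intro j _ hj
    rw [smul_mul_smul_comm, map_smul, ho i j hj.symm, smul_zero]
  · simp

theorem sum_neg_aux {F : Type*} [Field F] [LinearOrder F] [IsStrictOrderedRing F]
    {κ : Type*} [Fintype κ] (d c : κ → F) (hd : ∀ i, d i < 0) (hc : c ≠ 0) :
    ∑ i, c i * c i * d i < 0 := by
  obtain ⟨i, hi⟩ := Function.ne_iff.1 hc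
  refine Finset.sum_neg' (fun j _ => ?_) ⟨i, Finset.mem_univ i, ?_⟩
  · exact mul_nonpos_of_nonneg_of_nonpos (mul_self_nonneg _) (hd j).le
  · exact mul_neg_of_pos_of_neg (mul_self_pos.2 hi) (hd i)

/-- No real roots: at most half of the diagonal entries are positive. -/
theorem count_pos {F : Type*} [Field F] [LinearOrder F] [IsStrictOrderedRing F] (P : F[X])
    (hP : P.Monic) (h : DvdOneAddSq P) {κ : Type*} [Fintype κ] (u : κ → F[X])
    (ho : ∀ i j, i ≠ j → rho P (u i * u j) = 0) (hd : ∀ i, 0 < rho P (u i * u i)) :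
    2 * Fintype.card κ ≤ P.natDegree := by
  refine inertia_poly P hP h (-1) u (fun c hc => ?_)
  rw [rho_sq_expand P u ho, Finset.mul_sum]
  have := sum_neg_aux (fun i => - rho P (u i * u i)) c (fun i => by simpa using hd i) hc
  refine lt_of_eq_of_lt (Finset.sum_congr rfl (fun i _ => ?_)) this
  ring

/-- With a root: strictly less than half of the diagonal entries are negative. -/
theorem count_neg {F : Type*} [Field F] [LinearOrder F] [IsStrictOrderedRing F] (P : F[X])
    (hP : P.Monic) (h : ∀ q : F[X], q ≠ 0 → (∀ x, q.eval x ≠ 0) → DvdOneAddSq q)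
    (θ : F) (hθ : P.eval θ = 0) {κ : Type*} [Fintype κ] (u : κ → F[X])
    (ho : ∀ i j, i ≠ j → rho P (u i * u j) = 0) (hd : ∀ i, rho P (u i * u i) < 0) :
    2 * Fintype.card κ < P.natDegree := by
  obtain ⟨g, h1, h2, h3⟩ := exists_prod_multiset_X_sub_C_mul P
  have hm := monic_multiset_prod_of_monic P.roots (fun a => X - C a) (fun a _ => monic_X_sub_C a)
  have hg : g.Monic := by
    rw [← h1] at hP
    exact hm.of_mul_monic_left hP
  have hθr : θ ∈ P.roots := (mem_roots hP.ne_zero).2 hθ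
  have hcard : 0 < P.roots.card := Multiset.card_pos_iff_exists_mem.2 ⟨θ, hθr⟩
  have hgq : DvdOneAddSq g := h g hg.ne_zero (fun x hx => by
    have : x ∈ g.roots := (mem_roots hg.ne_zero).2 hx
    rw [h3] at this
    exact absurd this (Multiset.notMem_zero x))
  have := inertia_poly g hg hgq 1 u (fun c hc => by
    set v := ∑ i, c i • u i with hv
    have e := rho_prod P.roots g (v * v) hg
    rw [h1, hv, rho_sq_expand P u ho, ← hv] at e
    have e2 := sum_neg_aux (fun i => rho P (u i * u i)) c hd hc
    have e3 : 0 ≤ (P.roots.map (fun a => (v * v).eval a)).sum := by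
      apply Multiset.sum_nonneg
      intro x hx
      obtain ⟨a, -, rfl⟩ := Multiset.mem_map.1 hx
      rw [eval_mul]; exact mul_self_nonneg _
    linarith)
  omega

end Polynomial.HilbertPlane

namespace Polynomial.HilbertPlane

/-- clear denominators of a polynomial over the fraction field -/
theorem clear_denom {R : Type*} [CommRing R] [IsDomain R] (p : (FractionRing R)[X]) :
    ∃ (r : R) (P : R[X]), r ≠ 0 ∧ P.map (algebraMap R (FractionRing R)) =
      C (algebraMap R (FractionRing R) r) * p := by
  obtain ⟨b, hb0, hb⟩ := IsLocalization.integerNormalization_spec (nonZeroDivisors R) p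
  refine ⟨b, IsLocalization.integerNormalization (nonZeroDivisors R) p, nonZeroDivisors.ne_zero hb0, ?_⟩
  rw [hb]
  ext n
  simp [Algebra.smul_def]

theorem rhoQ_ne_zero {F : Type*} [Field F] [CharZero F] (g : F[X]) (hg : g.Monic) (hi : Irreducible g) :
    ∃ a, rhoQ g hg a ≠ 0 := by
  have := Fact.mk hi
  have hd : 0 < g.natDegree := hi.natDegree_pos
  have h1 : AdjoinRoot.mk g (derivative g) ≠ 0 := by
    rw [Ne, AdjoinRoot.mk_eq_zero]
    intro h
    have := (hi.separable : g.Separable)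
    exact hi.not_isUnit (this.isUnit_of_dvd' dvd_rfl h)
  obtain ⟨u, hu⟩ := AdjoinRoot.mk_surjective (g := g) ((AdjoinRoot.mk g (derivative g))⁻¹ *
    AdjoinRoot.mk g (X ^ (g.natDegree - 1)))
  refine ⟨AdjoinRoot.mk g u, ?_⟩
  rw [rhoQ_mk, rho_apply]
  have h2 : AdjoinRoot.mk g (derivative g * u) = AdjoinRoot.mk g (X ^ (g.natDegree - 1)) := by
    rw [map_mul, hu, mul_inv_cancel_left₀ h1]
  rw [AdjoinRoot.mk_eq_mk] at h2
  have h3 : (derivative g * u) %ₘ g = (X ^ (g.natDegree - 1)) %ₘ g := by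
    rw [← sub_eq_zero, ← sub_modByMonic, (modByMonic_eq_zero_iff_dvd hg).2 h2]
  rw [h3, (modByMonic_eq_self_iff hg).2]
  · simp
  · rw [degree_X_pow, degree_eq_natDegree hg.ne_zero]
    exact_mod_cast (by omega)

theorem exists_ortho {F : Type*} [Field F] [CharZero F] (g : F[X]) (hg : g.Monic) (hi : Irreducible g)
    {n : ℕ} (hn : g.natDegree = n) :
    ∃ u : Fin n → F[X], (∀ i j, i ≠ j → rho g (u i * u j) = 0) ∧
      ∀ i, rho g (u i * u i) ≠ 0 := by
  have := Fact.mk hi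
  let : Invertible (2 : F) := invertibleOfNonzero two_ne_zero
  obtain ⟨B, hB⟩ : ∃ B : LinearMap.BilinForm F (AdjoinRoot g),
      ∀ a b, B a b = rhoQ g hg (a * b) :=
    ⟨(LinearMap.mul F (AdjoinRoot g)).compr₂ (rhoQ g hg), fun a b => rfl⟩
  have : FiniteDimensional F (AdjoinRoot g) := (AdjoinRoot.powerBasis hg.ne_zero).finite
  have hfr : Module.finrank F (AdjoinRoot g) = n := by
    rw [(AdjoinRoot.powerBasis hg.ne_zero).finrank, AdjoinRoot.powerBasis_dim, hn]
  have hs : LinearMap.IsSymm B := ⟨fun a b => by simp [hB, mul_comm]⟩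
  obtain ⟨v, hv⟩ : ∃ v : Module.Basis (Fin n) F (AdjoinRoot g), B.IsOrthoᵢ v :=
    hfr ▸ LinearMap.BilinForm.exists_orthogonal_basis hs
  have hv' : ∀ i j, i ≠ j → rhoQ g hg (v i * v j) = 0 := fun i j hij => by
    rw [← hB]; exact LinearMap.isOrthoᵢ_def.1 hv i j hij
  choose u hu using fun i => AdjoinRoot.mk_surjective (g := g) (v i)
  have hrho : ∀ i j, rho g (u i * u j) = rhoQ g hg (v i * v j) := by
    intro i j
    rw [← rhoQ_mk g hg, map_mul, hu, hu]
  refine ⟨u, fun i j hij => ?_, fun i h => ?_⟩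
  · rw [hrho]
    exact hv' _ _ hij
  · rw [hrho] at h
    obtain ⟨a, ha⟩ := rhoQ_ne_zero g hg hi
    apply ha
    have h0 : B (v i) = 0 := by
      refine v.ext fun j => ?_
      by_cases hij : i = j
      · subst hij; rw [hB, h]; rfl
      · rw [hB, hv' _ _ hij]; rfl
    have h1 : B (v i) ((v i)⁻¹ * a) = 0 := by rw [h0]; rfl
    rwa [hB, mul_inv_cancel_left₀ (v.ne_zero i)] at h1

theorem rho_C_mul {R : Type*} [CommRing R] (P u v : R[X]) (a b : R) :
    rho P (C a * u * (C b * v)) = a * b * rho P (u * v) := by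
  have : C a * u * (C b * v) = (a * b) • (u * v) := by
    rw [smul_eq_C_mul, C_mul]; ring
  rw [this, map_smul, smul_eq_mul]

theorem exists_ortho_int {R : Type*} [CommRing R] [IsDomain R] [CharZero R] (P : R[X]) (hP : P.Monic)
    (hi : Irreducible (P.map (algebraMap R (FractionRing R)))) :
    ∃ u : Fin P.natDegree → R[X], (∀ i j, i ≠ j → rho P (u i * u j) = 0) ∧
      ∀ i, rho P (u i * u i) ≠ 0 := by
  have : CharZero (FractionRing R) :=
    (algebraMap R (FractionRing R)).charZero_iff (IsFractionRing.injective R (FractionRing R)) |>.1 ‹_›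
  have hn : (P.map (algebraMap R (FractionRing R))).natDegree = P.natDegree := hP.natDegree_map _
  obtain ⟨u, h1, h2⟩ := exists_ortho _ (hP.map (algebraMap R (FractionRing R))) hi hn
  choose r U hr hU using fun i => clear_denom (u i)
  have key : ∀ i j, algebraMap R (FractionRing R) (rho P (U i * U j)) =
      algebraMap R (FractionRing R) (r i * r j) *
        rho (P.map (algebraMap R (FractionRing R))) (u i * u j) := by
    intro i j
    rw [← rho_map _ _ _ hP, Polynomial.map_mul, hU, hU, rho_C_mul, map_mul (algebraMap R (FractionRing R)) (r i)]
  refine ⟨U, fun i j hij => ?_, fun i h => ?_⟩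
  · have := key i j
    rw [h1 i j hij, mul_zero] at this
    exact (map_eq_zero_iff _ (IsFractionRing.injective R (FractionRing R))).1 this
  · have := key i i
    rw [h, map_zero, eq_comm, mul_eq_zero, map_eq_zero_iff _ (IsFractionRing.injective R (FractionRing R))] at this
    exact this.elim (mul_ne_zero (hr i) (hr i)) (h2 i)

end Polynomial.HilbertPlane

namespace Polynomial.HilbertPlane

theorem sumSq_mod {F : Type*} [Field F] (a : F) {s : F[X]} (hs : IsSumSq s) :
    ∃ s0 t0 r : F, IsSumSq s0 ∧ IsSumSq t0 ∧
      (X ^ 2 - C a) ∣ s - (C (s0 + a * t0) + C r * X) := by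
  induction hs with
  | zero => exact ⟨0, 0, 0, .zero, .zero, by simp⟩
  | @sq_add b s hs ih =>
    obtain ⟨s0, t0, r, h1, h2, k, hk⟩ := ih
    have hm : (X ^ 2 - C a).Monic := monic_X_pow_sub_C a two_ne_zero
    have hd : (b %ₘ (X ^ 2 - C a)).degree ≤ 1 := by
      have := degree_modByMonic_lt b hm
      rw [degree_X_pow_sub_C two_pos] at this
      exact Order.le_of_lt_succ this
    obtain ⟨c, d, hcd⟩ : ∃ c d, b %ₘ (X ^ 2 - C a) = C c * X + C d :=
      ⟨_, _, eq_X_add_C_of_degree_le_one hd⟩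
    have hb := modByMonic_add_div b (X ^ 2 - C a)
    rw [hcd] at hb
    set q := b /ₘ (X ^ 2 - C a)
    refine ⟨d * d + s0, c * c + t0, r + 2 * c * d, .sq_add d h1, .sq_add c h2,
      k + q * ((C c * X + C d) * 2 + (X ^ 2 - C a) * q) + C c ^ 2, ?_⟩
    rw [← hb]
    simp only [C_add, C_mul] at hk ⊢
    have : (C (2 : F)) = 2 := rfl
    rw [this]
    linear_combination hk

theorem sumSq_quad {F : Type*} [Field F] (a : F) (h : DvdOneAddSq (X ^ 2 - C a)) :
    ∃ s0 t0 : F, IsSumSq s0 ∧ IsSumSq t0 ∧ 1 + s0 + a * t0 = 0 := by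
  obtain ⟨s, hs, hd⟩ := h
  obtain ⟨s0, t0, r, h1, h2, h3⟩ := sumSq_mod a hs
  refine ⟨s0, t0, h1, h2, ?_⟩
  have h4 := dvd_sub hd h3
  have h5 : 1 + s - (s - (C (s0 + a * t0) + C r * X)) = C r * X + C (1 + s0 + a * t0) := by
    simp only [C_add, C_mul, C_1]; ring
  rw [h5] at h4
  have h6 : C r * X + C (1 + s0 + a * t0) = 0 := by
    apply eq_zero_of_dvd_of_degree_lt h4
    rw [degree_X_pow_sub_C two_pos]
    exact lt_of_le_of_lt degree_linear_le (by norm_num)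
  have := congrArg (fun p => coeff p 0) h6
  simpa using this

theorem sumSq_total {F : Type*} [Field F] (hn : ¬ IsSumSq (-1 : F))
    (h : ∀ q : F[X], Irreducible q → (∀ x, q.eval x ≠ 0) → DvdOneAddSq q) (a : F) :
    IsSumSq a ∨ IsSumSq (-a) := by
  by_cases ha : IsSquare a
  · exact .inl ha.isSumSq
  right
  have hnr : ∀ x, (X ^ 2 - C a).eval x ≠ 0 := by
    intro x hx
    apply ha
    refine ⟨x, ?_⟩
    simp [sub_eq_zero] at hx
    rw [← hx, sq]
  have hirr : Irreducible (X ^ 2 - C a) := by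
    have hnd : (X ^ 2 - C a).natDegree = 2 := natDegree_X_pow_sub_C
    refine irreducible_of_degree_le_three_of_not_isRoot ?_ hnr
    rw [hnd]; simp
  obtain ⟨s0, t0, h1, h2, h3⟩ := sumSq_quad a (h _ hirr hnr)
  have ht : t0 ≠ 0 := by
    rintro rfl
    apply hn
    have : (-1 : F) = s0 := by linear_combination - h3
    rwa [this]
  have : -a = ((t0⁻¹) ^ 2) * ((1 + s0) * t0) := by
    field_simp
    linear_combination -h3
  rw [this]
  exact isSumSq_smul_sq _ ((IsSumSq.add (IsSquare.one.isSumSq) h1).mul h2)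

theorem exists_order {F : Type*} [Field F] (hn : ¬ IsSumSq (-1 : F))
    (ht : ∀ a : F, IsSumSq a ∨ IsSumSq (-a)) :
    ∃ _ : LinearOrder F, IsStrictOrderedRing F := by
  classical
  let K : RingCone F :=
    { carrier := {a | IsSumSq a}
      zero_mem' := .zero
      one_mem' := IsSquare.one.isSumSq
      add_mem' := fun h1 h2 => IsSumSq.add h1 h2
      mul_mem' := fun h1 h2 => IsSumSq.mul h1 h2
      eq_zero_of_mem_of_neg_mem' := by
        intro a h1 h2
        by_contra ha
        apply hn
        have : (-1 : F) = (a⁻¹) ^ 2 * (a * -a) := by field_simp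
        rw [this]
        exact isSumSq_smul_sq _ (IsSumSq.mul h1 h2) }
  have : HasMemOrNegMem K := ⟨ht⟩
  let L : LinearOrder F := .mkOfAddGroupCone K
  have : IsOrderedRing F := .mkOfCone K
  exact ⟨L, IsOrderedRing.toIsStrictOrderedRing F⟩

theorem sSup_chain {E L : Type*} [Field E] [Field L] [Algebra E L] (c : Set (IntermediateField E L))
    (hc : IsChain (· ≤ ·) c) (hne : c.Nonempty) (s : (sSup c : IntermediateField E L))
    (hs : IsSumSq s) : ∃ S ∈ c, ∃ t : S, IsSumSq t ∧ (t : L) = s := by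
  have hmem : ∀ b : L, b ∈ sSup c → ∃ S ∈ c, b ∈ S := by
    intro b hb
    have := Set.Nonempty.to_subtype hne
    rw [sSup_eq_iSup', ← SetLike.mem_coe, IntermediateField.coe_iSup_of_directed] at hb
    · simpa using hb
    · exact hc.directedOn.directed_val
  induction hs with
  | zero => 
    obtain ⟨S, hS⟩ := hne
    exact ⟨S, hS, 0, .zero, rfl⟩
  | @sq_add b s hs ih =>
    obtain ⟨S, hS, t, ht, hts⟩ := ih
    obtain ⟨S', hS', hb⟩ := hmem b b.2
    rcases hc.total hS hS' with h | h
    · refine ⟨S', hS', ⟨b, hb⟩ * ⟨b, hb⟩ + IntermediateField.inclusion h t,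
        .sq_add _ (isSumSq_map (IntermediateField.inclusion h).toRingHom ht), ?_⟩
      simp [hts]
    · refine ⟨S, hS, ⟨b, h hb⟩ * ⟨b, h hb⟩ + t, .sq_add _ ht, ?_⟩
      simp [hts]

theorem exists_maximal_real {E : Type*} [Field E] (hn : ¬ IsSumSq (-1 : E)) :
    ∃ S : IntermediateField E (AlgebraicClosure E), Maximal (fun S : IntermediateField E (AlgebraicClosure E) => ¬ IsSumSq (-1 : S)) S := by
  have h1 : ∀ c ⊆ {S : IntermediateField E (AlgebraicClosure E) | ¬ IsSumSq (-1 : S)},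
      IsChain (· ≤ ·) c → ∀ y ∈ c,
      ∃ ub ∈ {S : IntermediateField E (AlgebraicClosure E) | ¬ IsSumSq (-1 : S)}, ∀ z ∈ c, z ≤ ub := by
    intro c hcs hc y hy
    refine ⟨sSup c, fun hs => ?_, fun z hz => le_sSup hz⟩
    obtain ⟨S, hS, t, ht, h⟩ := sSup_chain c hc ⟨y, hy⟩ _ hs
    apply hcs hS
    have : t = -1 := Subtype.ext (by simpa using h)
    rwa [← this]
  have h2 : (⊥ : IntermediateField E (AlgebraicClosure E)) ∈
      {S : IntermediateField E (AlgebraicClosure E) | ¬ IsSumSq (-1 : S)} := by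
    intro h
    apply hn
    have := isSumSq_map (IntermediateField.botEquiv E (AlgebraicClosure E)).toRingEquiv.toRingHom h
    simpa using this
  obtain ⟨S, -, hS⟩ := zorn_le_nonempty₀ _ h1 ⊥ h2
  exact ⟨S, hS⟩

theorem exists_Omega {E : Type} [Field E] (hn : ¬ IsSumSq (-1 : E)) :
    ∃ (Ω : Type) (_ : Field Ω) (_ : LinearOrder Ω) (_ : IsStrictOrderedRing Ω) (_ : E →+* Ω),
      ∀ q : Polynomial Ω, Irreducible q → (∀ x, q.eval x ≠ 0) → DvdOneAddSq q := by
  obtain ⟨S, hS, hmax⟩ := exists_maximal_real hn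
  have key : ∀ q : S[X], Irreducible q → (∀ x, q.eval x ≠ 0) → DvdOneAddSq q := by
    intro q hq hr
    obtain ⟨α, hα⟩ := IsAlgClosed.exists_aeval_eq_zero (AlgebraicClosure E) q hq.degree_pos.ne'
    have hint : IsIntegral S α := IsAlgebraic.isIntegral ⟨q, hq.ne_zero, hα⟩
    have hαS : α ∉ S := by
      intro h
      apply hr ⟨α, h⟩
      apply Subtype.ext
      rw [show α = algebraMap S (AlgebraicClosure E) ⟨α, h⟩ from rfl,
        aeval_algebraMap_apply] at hα
      exact hα
    have h1 : IsSumSq (-1 : IntermediateField.adjoin S {α}) := by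
      by_contra h
      have h2 : S ≤ (IntermediateField.adjoin S {α}).restrictScalars E := fun x hx =>
        (IntermediateField.adjoin S {α}).algebraMap_mem ⟨x, hx⟩
      exact hαS (hmax (y := (IntermediateField.adjoin S {α}).restrictScalars E) h h2
        (IntermediateField.mem_adjoin_simple_self S α))
    have h3 := isSumSq_map (IntermediateField.adjoinRootEquivAdjoin S hint).symm.toRingEquiv.toRingHom h1
    have h4 : DvdOneAddSq (minpoly S α) := dvd_of_isSumSq_neg_one _ (by simpa using h3)
    obtain ⟨s, hs, hd⟩ := h4
    refine ⟨s, hs, dvd_trans ?_ hd⟩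
    exact ((minpoly.irreducible hint).dvd_symm hq (minpoly.dvd S α hα))
  obtain ⟨l, hl⟩ := exists_order hS (sumSq_total hS key)
  exact ⟨S, inferInstance, l, hl, algebraMap E S, key⟩

theorem dvdOneAddSq_of_irreducible {F : Type*} [Field F]
    (h : ∀ q : F[X], Irreducible q → (∀ x, q.eval x ≠ 0) → DvdOneAddSq q) (q : F[X]) (hq : q ≠ 0)
    (hr : ∀ x, q.eval x ≠ 0) : DvdOneAddSq q := by
  induction q using WfDvdMonoid.induction_on_irreducible with
  | zero => exact absurd rfl hq
  | unit u hu => exact ⟨0, .zero, hu.dvd⟩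
  | mul a i ha hi ih =>
    refine (h i hi fun x hx => hr x (by simp [hx])).mul (ih ha fun x hx => hr x (by simp [hx]))

end Polynomial.HilbertPlane

namespace Polynomial.HilbertPlane

theorem key_monic (P : ℝ[X][X]) (hP : P.Monic)
    (hi : Irreducible (P.map (algebraMap ℝ[X] (FractionRing ℝ[X])))) (r0 : ℝ[X]) (hr0 : r0 ≠ 0)
    (hnr : ∀ y, r0.eval y ≠ 0 → ∀ x, (P.map (evalRingHom y)).eval x ≠ 0) :
    DvdOneAddSq (P.map (algebraMap ℝ[X] (FractionRing ℝ[X]))) := by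
  have := Fact.mk hi
  apply dvd_of_isSumSq_neg_one
  by_contra hn
  obtain ⟨Ω, _, _, _, φ, hΩ⟩ := exists_Omega hn
  obtain ⟨u, ho, hd⟩ := exists_ortho_int P hP hi
  let ψ : ℝ[X] →+* Ω := φ.comp ((AdjoinRoot.of (P.map (algebraMap ℝ[X] (FractionRing ℝ[X])))).comp
    (algebraMap ℝ[X] (FractionRing ℝ[X])))
  have hψ : Function.Injective ψ := by
    intro a b h
    exact IsFractionRing.injective ℝ[X] (FractionRing ℝ[X]) ((AdjoinRoot.of _).injective (φ.injective h))
  have hroot : (P.map ψ).eval (φ (AdjoinRoot.root _)) = 0 := by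
    rw [eval_map, ← hom_eval₂, ← eval₂_map, AdjoinRoot.eval₂_root, map_zero]
  obtain ⟨y0, hy0⟩ := exists_sign_agree ψ hψ (fun o : Option (Fin P.natDegree) =>
    o.elim r0 (fun i => rho P (u i * u i))) (by rintro (_ | i); exacts [hr0, hd i])
  have hr : r0.eval y0 ≠ 0 := by
    rcases hy0 none with h | h
    exacts [h.1.ne', h.1.ne]
  have c1 := count_pos (P.map (evalRingHom y0)) (hP.map _) (dvdOneAddSq_of_no_root _ (hnr y0 hr))
    (fun i : {i // 0 < (rho P (u i * u i)).eval y0} => (u i).map (evalRingHom y0))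
    (fun i j hij => by
      rw [← Polynomial.map_mul, rho_map _ _ _ hP, ho _ _ (fun h => hij (Subtype.ext h)), map_zero])
    (fun i => by
      rw [← Polynomial.map_mul, rho_map _ _ _ hP]
      exact i.2)
  have c2 := count_neg (P.map ψ) (hP.map _) (dvdOneAddSq_of_irreducible hΩ) _ hroot
    (fun i : {i // ¬ 0 < (rho P (u i * u i)).eval y0} => (u i).map ψ)
    (fun i j hij => by
      rw [← Polynomial.map_mul, rho_map _ _ _ hP, ho _ _ (fun h => hij (Subtype.ext h)), map_zero])
    (fun i => by
      rw [← Polynomial.map_mul, rho_map _ _ _ hP]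
      rcases hy0 (some i.1) with h | h
      · exact absurd h.1 i.2
      · exact h.2)
  rw [hP.natDegree_map] at c1 c2
  have c3 := Fintype.card_subtype_compl (fun i => 0 < (rho P (u i * u i)).eval y0)
  have c4 := Fintype.card_subtype_le (fun i => 0 < (rho P (u i * u i)).eval y0)
  rw [Fintype.card_fin] at c3 c4
  omega

end Polynomial.HilbertPlane

namespace Polynomial.HilbertPlane

theorem comp_transfer {K : Type*} [Field K] (a c : K) (ha : a ≠ 0) (hc : c ≠ 0) (N P : K[X])
    (h : N.comp (C a * X) = C c * P) :
    (Irreducible P → Irreducible N) ∧ (DvdOneAddSq N → DvdOneAddSq P) := by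
  let := invertibleOfNonzero ha
  have he : ∀ p, algEquivCMulXAddC a 0 p = p.comp (C a * X) := by
    intro p
    simp [algEquivCMulXAddC_apply, comp, aeval_def, algebraMap_eq]
  have hu : IsUnit (C c) := isUnit_C.2 hc.isUnit
  constructor
  · intro hP
    rw [← MulEquiv.irreducible_iff (algEquivCMulXAddC a 0), he, h, irreducible_isUnit_mul hu]
    exact hP
  · rintro ⟨s, hs, t, ht⟩
    refine ⟨algEquivCMulXAddC a 0 s, isSumSq_map (algEquivCMulXAddC a 0).toRingEquiv.toRingHom hs, ?_⟩
    have := congrArg (algEquivCMulXAddC a 0) ht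
    rw [map_mul, he N, h, map_add, map_one] at this
    rw [this, mul_comm (C c), mul_assoc]
    exact dvd_mul_right _ _

theorem key_lemma (P : ℝ[X][X])
    (hi : Irreducible (P.map (algebraMap ℝ[X] (FractionRing ℝ[X])))) (r0 : ℝ[X]) (hr0 : r0 ≠ 0)
    (hnr : ∀ y, r0.eval y ≠ 0 → ∀ x, (P.map (evalRingHom y)).eval x ≠ 0) :
    DvdOneAddSq (P.map (algebraMap ℝ[X] (FractionRing ℝ[X]))) := by
  have hP0 : P ≠ 0 := by
    rintro rfl
    simp at hi
  have hn : 1 ≤ P.natDegree := by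
    have := hi.natDegree_pos
    exact this.trans_le natDegree_map_le
  set a := P.leadingCoeff with ha
  have ha0 : a ≠ 0 := leadingCoeff_ne_zero.2 hP0
  set N := P.integralNormalization with hN
  have hNm : N.Monic := monic_integralNormalization hP0
  set K := FractionRing ℝ[X]
  have haK : algebraMap ℝ[X] K a ≠ 0 := by
    rw [Ne, map_eq_zero_iff _ (IsFractionRing.injective ℝ[X] K)]; exact ha0
  have hcomp : (N.map (algebraMap ℝ[X] K)).comp (C (algebraMap ℝ[X] K a) * X) =
      C (algebraMap ℝ[X] K a ^ (P.natDegree - 1)) * P.map (algebraMap ℝ[X] K) := by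
    have := integralNormalization_eval₂_leadingCoeff_mul hn (C.comp (algebraMap ℝ[X] K)) X
    rw [← eval₂_map] at this
    rw [comp, C_pow]
    refine this.trans ?_
    rw [← eval₂_map, eval₂_C_X]
    rfl
  obtain ⟨t1, t2⟩ := comp_transfer _ _ haK (pow_ne_zero _ haK) _ _ hcomp
  refine t2 (key_monic N hNm (t1 hi) (a * r0) (mul_ne_zero ha0 hr0) ?_)
  intro y hy x hx
  rw [eval_mul] at hy
  have hay := left_ne_zero_of_mul hy
  apply hnr y (right_ne_zero_of_mul hy) ((a.eval y)⁻¹ * x)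
  have := integralNormalization_eval₂_leadingCoeff_mul hn (evalRingHom y) ((a.eval y)⁻¹ * x)
  rw [← ha, ← hN, coe_evalRingHom, mul_inv_cancel_left₀ hay, ← eval_map, ← eval_map, hx] at this
  exact (mul_eq_zero.1 this.symm).resolve_left (pow_ne_zero _ hay)

end Polynomial.HilbertPlane

namespace Polynomial.HilbertPlane

/-- evaluation of a polynomial in two variables -/
noncomputable def ev (y x : ℝ) : ℝ[X][X] →+* ℝ := (evalRingHom x).comp (mapRingHom (evalRingHom y))

theorem ev_apply (y x : ℝ) (f : ℝ[X][X]) : ev y x f = (f.map (evalRingHom y)).eval x := rfl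

@[simp] theorem ev_C (y x : ℝ) (c : ℝ[X]) : ev y x (C c) = c.eval y := by
  simp [ev_apply]

theorem ev_eq (y x : ℝ) (f : ℝ[X][X]) : ev y x f = (f.eval (C x)).eval y := by
  have : ev y x = (evalRingHom y).comp (evalRingHom (C x)) := by
    ext <;> simp [ev]
  rw [this]; rfl

theorem finite_roots (g : ℝ[X]) (hg : g ≠ 0) : {x | g.eval x = 0}.Finite := by
  refine (g.roots.toFinset.finite_toSet).subset fun x hx => ?_
  simpa [hg] using hx

theorem density (g F : ℝ[X][X]) (hg : g ≠ 0) (h : ∀ y x, ev y x g ≠ 0 → 0 ≤ ev y x F) (y x : ℝ) :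
    0 ≤ ev y x F := by
  have h1 : ∀ y, g.leadingCoeff.eval y ≠ 0 → ∀ x, 0 ≤ ev y x F := by
    intro y hy x
    have hgy : g.map (evalRingHom y) ≠ 0 := by
      intro h0
      apply hy
      have := congrArg (fun p => coeff p g.natDegree) h0
      simpa using this
    exact nonneg_of_nonneg_off_finite _ _ (finite_roots _ hgy) (fun x hx => h y x hx) x
  rw [ev_eq]
  refine nonneg_of_nonneg_off_finite _ _ (finite_roots _ (leadingCoeff_ne_zero.2 hg)) (fun y hy => ?_) y
  rw [← ev_eq]
  exact h1 y hy x

theorem ev_nonneg_of_isSumSq {S : ℝ[X][X]} (hS : IsSumSq S) (y x : ℝ) : 0 ≤ ev y x S :=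
  (isSumSq_map (ev y x) hS).nonneg

def Good (f : ℝ[X][X]) : Prop := ∃ h : ℝ[X][X], h ≠ 0 ∧ IsSumSq (h ^ 2 * f)

theorem good_of {f f' a S : ℝ[X][X]} (ha : a ≠ 0) (hS : IsSumSq S) (e : a ^ 2 * f = S * f')
    (h : Good f') : Good f := by
  obtain ⟨h, h0, hs⟩ := h
  refine ⟨h * a, mul_ne_zero h0 ha, ?_⟩
  have : (h * a) ^ 2 * f = S * (h ^ 2 * f') := by linear_combination h ^ 2 * e
  rw [this]
  exact hS.mul hs

theorem sumSq_reduce {F : Type*} [Field F] (p : F[X]) (hp : 0 < p.natDegree) {s : F[X]} (hs : IsSumSq s) :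
    ∃ s', IsSumSq s' ∧ p ∣ s - s' ∧ s'.natDegree ≤ 2 * (p.natDegree - 1) := by
  induction hs with
  | zero => exact ⟨0, .zero, by simp, by simp⟩
  | @sq_add b s hs ih =>
    obtain ⟨s', h1, ⟨k, h2⟩, h3⟩ := ih
    refine ⟨(b % p) * (b % p) + s', .sq_add _ h1, ?_, ?_⟩
    · have := EuclideanDomain.div_add_mod b p
      refine ⟨k + (b / p) * (b + b % p), ?_⟩
      linear_combination h2 - (b + b % p) * this
    · have hlt : (b % p).natDegree < p.natDegree := natDegree_mod_lt b hp.ne'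
      refine (natDegree_add_le _ _).trans (max_le (natDegree_mul_le.trans ?_) h3)
      omega

theorem dvd_reduce {F : Type*} [Field F] (p : F[X]) (hp : 0 < p.natDegree) (h : DvdOneAddSq p) :
    ∃ s q : F[X], IsSumSq s ∧ p * q = 1 + s ∧ q.natDegree < p.natDegree := by
  obtain ⟨s, hs, k, hk⟩ := h
  obtain ⟨s', h1, ⟨l, h2⟩, h3⟩ := sumSq_reduce p hp hs
  have h4 : p * (k - l) = 1 + s' := by linear_combination -hk + h2
  refine ⟨s', k - l, h1, h4, ?_⟩
  by_cases hq : k - l = 0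
  · rw [hq]; simpa using hp
  have h5 := natDegree_mul (ne_zero_of_natDegree_gt hp) hq
  rw [h4] at h5
  have h6 := natDegree_add_le 1 s'
  rw [natDegree_one, Nat.zero_max] at h6
  omega

theorem clear_sumSq {R : Type*} [CommRing R] [IsDomain R] {s : (FractionRing R)[X]} (hs : IsSumSq s) :
    ∃ (d : R) (S : R[X]), d ≠ 0 ∧ IsSumSq S ∧ S.map (algebraMap R (FractionRing R)) =
      C (algebraMap R (FractionRing R) d) ^ 2 * s := by
  induction hs with
  | zero => exact ⟨1, 0, one_ne_zero, .zero, by simp⟩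
  | @sq_add b s hs ih =>
    obtain ⟨d, S, h1, h2, h3⟩ := ih
    obtain ⟨r, B, h4, h5⟩ := clear_denom b
    refine ⟨d * r, (C d * B) * (C d * B) + C r ^ 2 * S, mul_ne_zero h1 h4,
      .sq_add _ (isSumSq_smul_sq _ h2), ?_⟩
    simp only [Polynomial.map_add, Polynomial.map_mul, Polynomial.map_pow, h3, h5, map_C, map_mul]
    ring

theorem map_K_injective : Function.Injective
    (Polynomial.map (algebraMap ℝ[X] (FractionRing ℝ[X]))) :=
  map_injective _ (IsFractionRing.injective _ _)

theorem C_K_ne_zero {r : ℝ[X]} (hr : r ≠ 0) : (C (algebraMap ℝ[X] (FractionRing ℝ[X]) r)) ≠ 0 := by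
  rw [Ne, C_eq_zero, map_eq_zero_iff _ (IsFractionRing.injective _ _)]
  exact hr

theorem dvd_clear (p f : ℝ[X][X]) (h : p.map (algebraMap ℝ[X] (FractionRing ℝ[X])) ∣
    f.map (algebraMap ℝ[X] (FractionRing ℝ[X]))) : ∃ r g, r ≠ 0 ∧ C r * f = p * g := by
  obtain ⟨k, hk⟩ := h
  obtain ⟨r, g, hr, hg⟩ := clear_denom k
  refine ⟨r, g, hr, map_K_injective ?_⟩
  rw [Polynomial.map_mul, Polynomial.map_mul, hg, hk, map_C]
  ring

theorem exists_factor (f : ℝ[X][X]) (hf : 0 < f.natDegree) : ∃ p : ℝ[X][X],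
    Irreducible (p.map (algebraMap ℝ[X] (FractionRing ℝ[X]))) ∧
    p.map (algebraMap ℝ[X] (FractionRing ℝ[X])) ∣ f.map (algebraMap ℝ[X] (FractionRing ℝ[X])) := by
  have h1 : 0 < (f.map (algebraMap ℝ[X] (FractionRing ℝ[X]))).natDegree := by
    rwa [natDegree_map_eq_of_injective (IsFractionRing.injective _ _)]
  obtain ⟨p, hp, hd⟩ := WfDvdMonoid.exists_irreducible_factor (not_isUnit_of_natDegree_pos _ h1)
    (ne_zero_of_natDegree_gt h1)
  obtain ⟨r, P, hr, hP⟩ := clear_denom p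
  have hu : IsUnit (C (algebraMap ℝ[X] (FractionRing ℝ[X]) r)) := by
    rw [isUnit_C, isUnit_iff_ne_zero, ← C_ne_zero]
    exact C_K_ne_zero hr
  refine ⟨P, ?_, ?_⟩
  · rw [hP, irreducible_isUnit_mul hu]; exact hp
  · rw [hP, hu.mul_left_dvd]; exact hd

end Polynomial.HilbertPlane

namespace Polynomial.HilbertPlane

theorem bezout_clear (p g : ℝ[X][X]) (hp : Irreducible (p.map (algebraMap ℝ[X] (FractionRing ℝ[X]))))
    (hg : ¬ p.map (algebraMap ℝ[X] (FractionRing ℝ[X])) ∣ g.map (algebraMap ℝ[X] (FractionRing ℝ[X]))) :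
    ∃ U V r, r ≠ 0 ∧ U * p + V * (derivative p * g) = C r := by
  have : CharZero (FractionRing ℝ[X]) :=
    (algebraMap ℝ[X] (FractionRing ℝ[X])).charZero_iff (IsFractionRing.injective _ _) |>.1 inferInstance
  have h1 : IsCoprime (p.map (algebraMap ℝ[X] (FractionRing ℝ[X])))
      (derivative (p.map (algebraMap ℝ[X] (FractionRing ℝ[X])))) := hp.separable
  have h2 := (hp.coprime_iff_not_dvd).2 hg
  obtain ⟨u, v, h⟩ := h1.mul_right h2
  obtain ⟨a, U, ha, hU⟩ := clear_denom u
  obtain ⟨b, V, hb, hV⟩ := clear_denom v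
  refine ⟨C b * U, C a * V, a * b, mul_ne_zero ha hb, map_K_injective ?_⟩
  simp only [Polynomial.map_add, Polynomial.map_mul, map_C, hU, hV, ← derivative_map, map_mul]
  linear_combination (C (algebraMap ℝ[X] (FractionRing ℝ[X]) a) *
    C (algebraMap ℝ[X] (FractionRing ℝ[X]) b)) * h

theorem no_root (f p g U V : ℝ[X][X]) (r r1 : ℝ[X]) (hf : ∀ y x, 0 ≤ ev y x f)
    (h1 : C r * f = p * g) (h2 : U * p + V * (derivative p * g) = C r1) (y : ℝ)
    (hy : (r * r1).eval y ≠ 0) (x : ℝ) : (p.map (evalRingHom y)).eval x ≠ 0 := by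
  intro hx
  rw [eval_mul] at hy
  have hr := left_ne_zero_of_mul hy
  have hr1 := right_ne_zero_of_mul hy
  have e1 := congrArg (ev y x) h1
  have e2 := congrArg (ev y x) h2
  have e3 := congrArg (fun q => ev y x (derivative q)) h1
  have hpx : ev y x p = 0 := hx
  simp only [derivative_mul, derivative_C, zero_mul, zero_add, map_mul, map_add, ev_C, hpx, mul_zero,
    add_zero] at e1 e2 e3
  have hfx : ev y x f = 0 := (mul_eq_zero.1 e1).resolve_left hr
  have hd : ev y x (derivative f) = 0 := by
    have := deriv_zero_of_nonneg (f.map (evalRingHom y)) (hf y) x hfx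
    rwa [derivative_map] at this
  rw [hd, mul_zero] at e3
  rw [← e3, mul_zero] at e2
  exact hr1 e2.symm

theorem exists_eval_ne_zero (r : ℝ[X]) (hr : r ≠ 0) : ∃ y, r.eval y ≠ 0 := by
  by_contra! h
  exact hr (funext (by simpa using h))

/-- clear denominators in `p ∣ 1 + s` -/
theorem exists_multiplier (p : ℝ[X][X]) (hp : 0 < p.natDegree)
    (h : DvdOneAddSq (p.map (algebraMap ℝ[X] (FractionRing ℝ[X])))) :
    ∃ Q : ℝ[X][X], Q.natDegree < p.natDegree ∧ IsSumSq (p * Q) ∧ p * Q ≠ 0 := by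
  have hn : (p.map (algebraMap ℝ[X] (FractionRing ℝ[X]))).natDegree = p.natDegree :=
    natDegree_map_eq_of_injective (IsFractionRing.injective _ _) p
  obtain ⟨s, q, hs, hq, hlt⟩ := dvd_reduce _ (hn ▸ hp) h
  obtain ⟨d, S, hd, hS, hSs⟩ := clear_sumSq hs
  obtain ⟨e, Q, he, hQ⟩ := clear_denom q
  have key : p * (C (d ^ 2 * e) * Q) = C e ^ 2 * (C d ^ 2 + S) := by
    apply map_K_injective
    simp only [Polynomial.map_add, Polynomial.map_mul, Polynomial.map_pow, map_C, hSs, hQ, map_mul,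
      map_pow]
    linear_combination (C (algebraMap ℝ[X] (FractionRing ℝ[X]) e)) ^ 2 *
      (C (algebraMap ℝ[X] (FractionRing ℝ[X]) d)) ^ 2 * hq
  refine ⟨C (d ^ 2 * e) * Q, ?_, ?_, ?_⟩
  · refine lt_of_le_of_lt (natDegree_C_mul_le _ _) ?_
    rw [← hn]
    refine lt_of_eq_of_lt ?_ hlt
    rw [← natDegree_map_eq_of_injective (IsFractionRing.injective ℝ[X] (FractionRing ℝ[X])) Q, hQ,
      natDegree_C_mul]
    exact C_ne_zero.1 (C_K_ne_zero he)
  · rw [key]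
    refine isSumSq_smul_sq _ ?_
    rw [sq]
    exact .sq_add _ hS
  · obtain ⟨y, hy⟩ := exists_eval_ne_zero (d * e) (mul_ne_zero hd he)
    rw [eval_mul] at hy
    rw [key]
    intro h0
    have h1 := congrArg (ev y 0) h0
    have h2 := ev_nonneg_of_isSumSq hS y 0
    have hd' := left_ne_zero_of_mul hy
    have he' := right_ne_zero_of_mul hy
    simp only [map_mul, map_add, map_pow, ev_C, map_zero] at h1
    have : 0 < (e.eval y) ^ 2 * ((d.eval y) ^ 2 + ev y 0 S) := by positivity
    exact this.ne' h1

theorem good_of_nonneg (n : ℕ) : ∀ f : ℝ[X][X], f.natDegree = n → (∀ y x, 0 ≤ ev y x f) → Good f := by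
  induction n using Nat.strong_induction_on with
  | _ n ih =>
  intro f hn hf
  rcases Nat.eq_zero_or_pos n with h0 | hpos
  · rw [h0] at hn
    obtain ⟨c, rfl⟩ := natDegree_eq_zero.1 hn
    refine ⟨1, one_ne_zero, ?_⟩
    rw [one_pow, one_mul]
    exact isSumSq_map C (isSumSq_of_nonneg c fun y => by simpa using hf y 0)
  rw [← hn] at hpos
  have hf0 : f ≠ 0 := ne_zero_of_natDegree_gt hpos
  obtain ⟨p, hp, hpf⟩ := exists_factor f hpos
  have hpd : 0 < p.natDegree := by
    have := hp.natDegree_pos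
    rwa [natDegree_map_eq_of_injective (IsFractionRing.injective _ _)] at this
  have hp0 : p ≠ 0 := ne_zero_of_natDegree_gt hpd
  obtain ⟨r, g, hr, hfg⟩ := dvd_clear p f hpf
  have hCr : (C r : ℝ[X][X]) ≠ 0 := C_ne_zero.2 hr
  have hg0 : g ≠ 0 := by
    rintro rfl
    rw [mul_zero] at hfg
    exact mul_ne_zero hCr hf0 hfg
  have hdeg : f.natDegree = p.natDegree + g.natDegree := by
    rw [← natDegree_mul hp0 hg0, ← hfg, natDegree_C_mul hr]
  by_cases hdvd : p.map (algebraMap ℝ[X] (FractionRing ℝ[X])) ∣ g.map (algebraMap ℝ[X] (FractionRing ℝ[X]))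
  · obtain ⟨r', g', hr', hg'⟩ := dvd_clear p g hdvd
    have hCr' : (C r' : ℝ[X][X]) ≠ 0 := C_ne_zero.2 hr'
    have hgz : g' ≠ 0 := by
      rintro rfl
      rw [mul_zero] at hg'
      exact mul_ne_zero hCr' hg0 hg'
    have hdeg' : g.natDegree = p.natDegree + g'.natDegree := by
      rw [← natDegree_mul hp0 hgz, ← hg', natDegree_C_mul hr']
    have e : (C r * C r') ^ 2 * f = p ^ 2 * (C (r * r') * g') := by
      rw [C_mul]
      linear_combination C r * C r' ^ 2 * hfg + C r * C r' * p * hg'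
    refine good_of (mul_ne_zero hCr hCr') (IsSquare.sq p).isSumSq e (ih _ ?_ _ rfl ?_)
    · rw [natDegree_C_mul (mul_ne_zero hr hr')]
      omega
    · refine density p _ hp0 fun y x hyx => ?_
      have := congrArg (ev y x) e
      rw [map_mul, map_mul (ev y x) (p ^ 2), map_pow, map_pow] at this
      have h1 : 0 < (ev y x p) ^ 2 := by positivity
      have h2 : 0 ≤ ev y x p ^ 2 * ev y x (C (r * r') * g') := by
        rw [← this]; exact mul_nonneg (sq_nonneg _) (hf y x)
      exact nonneg_of_mul_nonneg_right h2 h1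
  · obtain ⟨U, V, r1, hr1, hUV⟩ := bezout_clear p g hp hdvd
    have hkey := key_lemma p hp (r * r1) (mul_ne_zero hr hr1)
      (no_root f p g U V r r1 hf hfg hUV)
    obtain ⟨Q, hQd, hQs, hQ0⟩ := exists_multiplier p hpd hkey
    have hQ : Q ≠ 0 := right_ne_zero_of_mul hQ0
    have e : (Q * C r) ^ 2 * f = (p * Q) * (C r * (Q * g)) := by
      linear_combination Q ^ 2 * C r * hfg
    refine good_of (mul_ne_zero hQ hCr) hQs e (ih _ ?_ _ rfl ?_)
    · rw [natDegree_C_mul hr, natDegree_mul hQ hg0]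
      omega
    · refine density _ _ hQ0 fun y x hyx => ?_
      have := congrArg (ev y x) e
      rw [map_mul, map_mul (ev y x) (p * Q), map_pow] at this
      have h1 : 0 < ev y x (p * Q) := lt_of_le_of_ne (ev_nonneg_of_isSumSq hQs y x) hyx.symm
      have h2 : 0 ≤ ev y x (p * Q) * ev y x (C r * (Q * g)) := by
        rw [← this]; exact mul_nonneg (sq_nonneg _) (hf y x)
      exact nonneg_of_mul_nonneg_right h2 h1

end Polynomial.HilbertPlane

namespace Polynomial.HilbertPlane

theorem cassels {K : Type*} [Field K] {m : ℕ}
    (hK : ∀ r : Fin m → K[X], ∑ i, r i ^ 2 = 0 → ∀ i, r i = 0) (f : K[X]) (n : ℕ) :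
    ∀ (h : K[X]) (g : Fin m → K[X]), h.natDegree = n → h ≠ 0 → h ^ 2 * f = ∑ i, g i ^ 2 →
      ∃ a : Fin m → K[X], f = ∑ i, a i ^ 2 := by
  induction n using Nat.strong_induction_on with
  | _ n ih =>
  intro h g hn h0 hg
  have hdiv : ∀ i, h * (g i / h) + g i % h = g i := fun i => EuclideanDomain.div_add_mod _ _
  set a : Fin m → K[X] := fun i => g i / h with ha
  by_cases hr : ∑ i, (g i % h) ^ 2 = 0
  · have hr' := hK _ hr
    refine ⟨a, mul_left_cancel₀ (pow_ne_zero 2 h0) ?_⟩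
    rw [hg, Finset.mul_sum]
    refine Finset.sum_congr rfl fun i _ => ?_
    have := hdiv i
    rw [hr' i, add_zero] at this
    rw [← this]; simp only [ha]; ring
  have hnpos : h.natDegree ≠ 0 := by
    intro hz
    apply hr
    refine Finset.sum_eq_zero fun i _ => ?_
    obtain ⟨c, rfl⟩ := natDegree_eq_zero.1 hz
    have : IsUnit (C c) := isUnit_C.2 (C_ne_zero.1 h0).isUnit
    rw [EuclideanDomain.mod_eq_zero.2 this.dvd]
    ring
  set A := ∑ i, a i ^ 2 with hA
  set B := ∑ i, a i * g i with hB
  have e1 : ∑ i, (g i % h) ^ 2 = h * (h * A + h * f - 2 * B) := by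
    have : ∑ i, (g i % h) ^ 2 = ∑ i, g i ^ 2 - 2 * h * B + h ^ 2 * A := by
      rw [hA, hB, Finset.mul_sum, Finset.mul_sum, ← Finset.sum_sub_distrib, ← Finset.sum_add_distrib]
      refine Finset.sum_congr rfl fun i _ => ?_
      have h1 : g i % h = g i - h * a i := by
        simp only [ha]; linear_combination hdiv i
      rw [h1]; ring
    rw [this, ← hg]; ring
  rw [e1] at hr
  have hhz : h * A + h * f - 2 * B ≠ 0 := right_ne_zero_of_mul hr
  have hdeg : (h * A + h * f - 2 * B).natDegree < n := by
    have h1 := natDegree_mul h0 hhz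
    rw [← e1] at h1
    have h2 : (∑ i, (g i % h) ^ 2).natDegree ≤ 2 * (h.natDegree - 1) := by
      refine natDegree_sum_le_of_forall_le _ _ fun i _ => ?_
      refine natDegree_pow_le.trans ?_
      have := natDegree_mod_lt (g i) hnpos
      omega
    omega
  refine ih _ hdeg (h * A + h * f - 2 * B) (fun i => (A - f) * g i - 2 * (B - h * f) * a i) rfl hhz ?_
  have : ∑ i, ((A - f) * g i - 2 * (B - h * f) * a i) ^ 2 =
      (A - f) ^ 2 * ∑ i, g i ^ 2 - 4 * (A - f) * (B - h * f) * B + 4 * (B - h * f) ^ 2 * A := by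
    conv_rhs => rw [hA, hB]
    rw [Finset.mul_sum, Finset.mul_sum, Finset.mul_sum,
      ← Finset.sum_sub_distrib, ← Finset.sum_add_distrib]
    refine Finset.sum_congr rfl fun i _ => ?_
    ring
  rw [this, ← hg]; ring

theorem eq_zero_of_ev (F : ℝ[X][X]) (h : ∀ y x, ev y x F = 0) : F = 0 := by
  by_contra hF
  obtain ⟨y, hy⟩ := exists_eval_ne_zero _ (leadingCoeff_ne_zero.2 hF)
  apply hy
  have : F.map (evalRingHom y) = 0 := Polynomial.funext fun x => by
    rw [eval_zero]; exact h y x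
  have := congrArg (fun p => coeff p F.natDegree) this
  simpa using this

theorem real_K {b s : (FractionRing ℝ[X])[X]} (hs : IsSumSq s) (h : b ^ 2 + s = 0) : b = 0 := by
  obtain ⟨d, S, hd, hS, hSs⟩ := clear_sumSq hs
  obtain ⟨r, B, hr, hB⟩ := clear_denom b
  have e : (C d * B) ^ 2 + C r ^ 2 * S = 0 := by
    apply map_K_injective
    simp only [Polynomial.map_add, Polynomial.map_mul, Polynomial.map_pow, map_C, hSs, hB,
      Polynomial.map_zero]
    linear_combination (C (algebraMap ℝ[X] (FractionRing ℝ[X]) r)) ^ 2 *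
      (C (algebraMap ℝ[X] (FractionRing ℝ[X]) d)) ^ 2 * h
  have hz : C d * B = 0 := by
    apply eq_zero_of_ev
    intro y x
    have h1 := congrArg (ev y x) e
    have h2 := ev_nonneg_of_isSumSq (isSumSq_smul_sq (C r) hS) y x
    rw [map_add, map_pow, map_zero] at h1
    have h3 := sq_nonneg (ev y x (C d * B))
    exact pow_eq_zero_iff two_ne_zero |>.1 (by linarith)
  have hB0 : B = 0 := (mul_eq_zero.1 hz).resolve_left (C_ne_zero.2 hd)
  rw [hB0, Polynomial.map_zero, eq_comm] at hB
  exact (mul_eq_zero.1 hB).resolve_left (C_K_ne_zero hr)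

theorem real_K_sum {m : ℕ} (r : Fin m → (FractionRing ℝ[X])[X]) (h : ∑ i, r i ^ 2 = 0) (i : Fin m) :
    r i = 0 := by
  rw [← Finset.add_sum_erase _ _ (Finset.mem_univ i)] at h
  exact real_K (IsSumSq.sum_sq _ _) h

theorem exists_const_denom (f : ℝ[X][X]) (hf : ∀ y x, 0 ≤ ev y x f) :
    ∃ (m : ℕ) (h : ℝ[X]) (G : Fin m → ℝ[X][X]), h ≠ 0 ∧ C h ^ 2 * f = ∑ i, G i ^ 2 := by
  obtain ⟨h, h0, hs⟩ := good_of_nonneg _ f rfl hf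
  obtain ⟨m, g, hg⟩ := isSumSq_iff_fin.1 hs
  have e : (h.map (algebraMap ℝ[X] (FractionRing ℝ[X]))) ^ 2 * f.map (algebraMap ℝ[X] (FractionRing ℝ[X]))
      = ∑ i, ((g i).map (algebraMap ℝ[X] (FractionRing ℝ[X]))) ^ 2 := by
    rw [← Polynomial.map_pow, ← Polynomial.map_mul, hg, Polynomial.map_sum]
    simp only [Polynomial.map_pow]
  have hK0 : h.map (algebraMap ℝ[X] (FractionRing ℝ[X])) ≠ 0 := by
    intro hz
    exact h0 (map_K_injective (by simpa using hz))
  obtain ⟨a, ha⟩ := cassels real_K_sum _ _ _ _ rfl hK0 e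
  obtain ⟨d, S, hd, hS, hSs⟩ := clear_sumSq (isSumSq_iff_fin.2 ⟨m, a, ha⟩)
  obtain ⟨m', G, hG⟩ := isSumSq_iff_fin.1 hS
  refine ⟨m', d, G, hd, ?_⟩
  rw [← hG]
  apply map_K_injective
  simp only [Polynomial.map_mul, Polynomial.map_pow, map_C, hSs]

theorem cleanup {m : ℕ} (f : ℝ[X][X]) (n : ℕ) : ∀ (h : ℝ[X]) (G : Fin m → ℝ[X][X]), h.natDegree = n →
    h ≠ 0 → C h ^ 2 * f = ∑ i, G i ^ 2 →
    ∃ (h : ℝ[X]) (G : Fin m → ℝ[X][X]), (∀ y, h.eval y ≠ 0) ∧ C h ^ 2 * f = ∑ i, G i ^ 2 := by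
  induction n with
  | zero =>
    intro h G hn h0 e
    refine ⟨h, G, fun y => ?_, e⟩
    obtain ⟨c, rfl⟩ := natDegree_eq_zero.1 hn
    simpa using h0
  | succ n ih =>
    intro h G hn h0 e
    by_cases hr : ∃ c, h.eval c = 0
    swap
    · exact ⟨h, G, fun y hy => hr ⟨y, hy⟩, e⟩
    obtain ⟨c, hc⟩ := hr
    obtain ⟨h1, rfl⟩ := dvd_iff_isRoot.2 hc
    have hdvd : ∀ i, C (X - C c) ∣ G i := by
      intro i
      rw [C_dvd_iff_dvd_coeff]
      intro k
      rw [dvd_iff_isRoot]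
      have h2 : (G i).map (evalRingHom c) = 0 := by
        refine Polynomial.funext fun x => ?_
        have h3 := congrArg (ev c x) e
        simp only [map_mul, map_pow, map_sum, ev_C, eval_mul, eval_sub, eval_X, eval_C, sub_self,
          zero_mul, ne_eq, OfNat.ofNat_ne_zero, not_false_eq_true, zero_pow] at h3
        have h4 := (Finset.sum_eq_zero_iff_of_nonneg (fun i _ => sq_nonneg (ev c x (G i)))).1 h3.symm i
          (Finset.mem_univ i)
        have h5 : ev c x (G i) = 0 := by simpa using h4
        rw [eval_zero]; exact h5
      have := congrArg (fun p => coeff p k) h2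
      simpa using this
    choose G' hG' using hdvd
    have hX : (C (X - C c) : ℝ[X][X]) ≠ 0 := C_ne_zero.2 (X_sub_C_ne_zero c)
    have h10 : h1 ≠ 0 := right_ne_zero_of_mul h0
    refine ih h1 G' ?_ h10 ?_
    · rw [natDegree_mul (X_sub_C_ne_zero c) h10, natDegree_X_sub_C] at hn
      omega
    · refine mul_left_cancel₀ (pow_ne_zero 2 hX) ?_
      rw [Finset.mul_sum]
      simp only [← mul_pow, ← hG', ← e, ← C_mul]
      rw [C_mul]; ring

theorem main (f : ℝ[X][X]) (hf : ∀ y x, 0 ≤ ev y x f) :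
    ∃ (m : ℕ) (h : ℝ[X]) (G : Fin m → ℝ[X][X]), (∀ y, h.eval y ≠ 0) ∧ C h ^ 2 * f = ∑ i, G i ^ 2 := by
  obtain ⟨m, h, G, h0, e⟩ := exists_const_denom f hf
  exact ⟨m, cleanup f _ h G rfl h0 e⟩

noncomputable def toP : MvPolynomial (Fin 2) ℝ →+* ℝ[X][X] :=
  MvPolynomial.eval₂Hom (C.comp C) ![C X, X]

noncomputable def ofP : ℝ[X][X] →+* MvPolynomial (Fin 2) ℝ :=
  eval₂RingHom (eval₂RingHom MvPolynomial.C (MvPolynomial.X 0)) (MvPolynomial.X 1)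

theorem ev_toP (v : Fin 2 → ℝ) (p : MvPolynomial (Fin 2) ℝ) :
    ev (v 0) (v 1) (toP p) = MvPolynomial.eval v p := by
  have : (ev (v 0) (v 1)).comp toP = MvPolynomial.eval v := by
    apply MvPolynomial.ringHom_ext
    · intro r; simp [toP]
    · intro i; fin_cases i <;> simp [toP, ev_apply]
  rw [← this]; rfl

theorem eval_ofP (v : Fin 2 → ℝ) (g : ℝ[X][X]) :
    MvPolynomial.eval v (ofP g) = ev (v 0) (v 1) g := by
  have : (MvPolynomial.eval v).comp ofP = ev (v 0) (v 1) := by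
    ext <;> simp [ofP, ev]
  rw [← this]; rfl

end Polynomial.HilbertPlane

open Polynomial.HilbertPlane in
theorem nonneg_regular_is_sum_of_squares_of_regular
    (f : (Fin 2 → ℝ) → ℝ) (hf : RegularR2 f) (hpos : ∀ x, 0 ≤ f x) :
    ∃ (m : ℕ) (F : Fin m → (Fin 2 → ℝ) → ℝ), (∀ i, RegularR2 (F i)) ∧
      ∀ x, f x = ∑ i, F i x ^ 2 := by
  obtain ⟨p, q, hq, hfx⟩ := hf
  obtain ⟨m, h, G, hh, e⟩ := Polynomial.HilbertPlane.main (toP (p * q)) (by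
    intro y x
    have h1 := ev_toP ![y, x] (p * q)
    simp only [Matrix.cons_val_zero, Matrix.cons_val_one] at h1
    rw [h1, map_mul]
    have h2 := hpos ![y, x]
    rw [hfx] at h2
    have h3 := hq ![y, x]
    have : eval ![y, x] p * eval ![y, x] q =
        eval ![y, x] p / eval ![y, x] q * (eval ![y, x] q) ^ 2 := by field_simp
    rw [this]
    exact mul_nonneg h2 (sq_nonneg _))
  refine ⟨m, fun i x => eval x (ofP (G i)) / eval x (ofP (Polynomial.C h) * q), fun i =>
    ⟨ofP (G i), ofP (Polynomial.C h) * q, fun x => ?_, fun x => rfl⟩, fun x => ?_⟩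
  · rw [map_mul, eval_ofP, ev_C]
    exact mul_ne_zero (hh _) (hq x)
  · have h1 := congrArg (ev (x 0) (x 1)) e
    rw [map_mul, map_pow, ev_C, ev_toP, map_sum, map_mul] at h1
    simp only [map_pow] at h1
    simp only [div_pow]
    rw [← Finset.sum_div]
    simp only [map_mul, eval_ofP, ev_C]
    rw [← h1, hfx]
    have h2 := hh (x 0)
    have h3 := hq x
    field_simp
end

section
/- Let k ≥ 1 be an integer and let f : ℝ² → ℝ be a [1]-regulous function. Then for every integer m ≥ 2k, the pointwise power f^m : x ↦ f(x)^m is k-flat: for every a ∈ ℝ² with f(a) = 0, the function f^m is of class C^k at a (ContDiffAt) and iteratedFDeriv ℝ j f^m at a is zero for every j with 0 ≤ j ≤ k. -/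
open MvPolynomial

/-- The polynomial `y ↦ q(a + y)`. -/
noncomputable def shiftPoly (a : Fin 2 → ℝ) (q : MvPolynomial (Fin 2) ℝ) :
    MvPolynomial (Fin 2) ℝ :=
  bind₁ (fun i => C (a i) + X i) q

/-- The lowest-degree nonzero homogeneous component of `y ↦ q(a + y)` is positive
definite: it takes positive values at every `y ≠ 0`. -/
def LocPosDef (q : MvPolynomial (Fin 2) ℝ) (a : Fin 2 → ℝ) : Prop :=
  ∃ m : ℕ, homogeneousComponent m (shiftPoly a q) ≠ 0 ∧
    (∀ d < m, homogeneousComponent d (shiftPoly a q) = 0) ∧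
    ∀ y : Fin 2 → ℝ, y ≠ 0 → 0 < eval y (homogeneousComponent m (shiftPoly a q))

/-- `p, q` is a representation of `f` witnessing that `f` is [1]-regulous:
`p` and `q` are relatively prime, `q ≥ 0` on `ℝ²` with finite zero set, `f = p/q` off
`Z(q)`, and at every point of `Z(q)` the lowest-degree homogeneous component of `q` is
positive definite. -/
def OneRegulousRep (f : (Fin 2 → ℝ) → ℝ) (p q : MvPolynomial (Fin 2) ℝ) : Prop :=
  IsRelPrime p q ∧ (∀ x : Fin 2 → ℝ, 0 ≤ eval x q) ∧
    {x : Fin 2 → ℝ | eval x q = 0}.Finite ∧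
    (∀ x : Fin 2 → ℝ, eval x q ≠ 0 → f x = eval x p / eval x q) ∧
    ∀ a : Fin 2 → ℝ, eval a q = 0 → LocPosDef q a

/-- `f : ℝ² → ℝ` is [1]-regulous: continuous, and a rational function which becomes
regular after one stage of blowings-up of points. -/
def OneRegulous (f : (Fin 2 → ℝ) → ℝ) : Prop :=
  Continuous f ∧ ∃ p q : MvPolynomial (Fin 2) ℝ, OneRegulousRep f p q



open Filter Topology

lemma ord_pderiv {n : ℕ} {P : MvPolynomial (Fin 2) ℝ} (i : Fin 2)
    (h : P ∈ idealOfVars (Fin 2) ℝ ^ n) : pderiv i P ∈ idealOfVars (Fin 2) ℝ ^ (n - 1) := by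
  rw [mem_pow_idealOfVars_iff'] at h ⊢
  intro x hx
  rw [coeff_pderiv, h]
  · simp
  · simp only [map_add, Finsupp.degree_single]
    omega

lemma ord_mono {n k : ℕ} {P : MvPolynomial (Fin 2) ℝ} (hk : k ≤ n)
    (h : P ∈ idealOfVars (Fin 2) ℝ ^ n) : P ∈ idealOfVars (Fin 2) ℝ ^ k :=
  Ideal.pow_le_pow_right hk h

lemma ord_mul {n k l : ℕ} {P Q : MvPolynomial (Fin 2) ℝ} (hl : l ≤ n + k)
    (h : P ∈ idealOfVars (Fin 2) ℝ ^ n) (h' : Q ∈ idealOfVars (Fin 2) ℝ ^ k) :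
    P * Q ∈ idealOfVars (Fin 2) ℝ ^ l :=
  ord_mono hl (by rw [pow_add]; exact Ideal.mul_mem_mul h h')

lemma ord_pow {n : ℕ} {P : MvPolynomial (Fin 2) ℝ} (m : ℕ)
    (h : P ∈ idealOfVars (Fin 2) ℝ ^ n) : P ^ m ∈ idealOfVars (Fin 2) ℝ ^ (n * m) := by
  rw [pow_mul]; exact Ideal.pow_mem_pow h m

lemma ord_bound {n : ℕ} {P : MvPolynomial (Fin 2) ℝ}
    (h : P ∈ idealOfVars (Fin 2) ℝ ^ n) :
    ∃ C : ℝ, 0 ≤ C ∧ ∀ y : Fin 2 → ℝ, ‖y‖ ≤ 1 → |eval y P| ≤ C * ‖y‖ ^ n := by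
  rw [mem_pow_idealOfVars_iff] at h
  refine ⟨∑ s ∈ P.support, |P.coeff s|, Finset.sum_nonneg fun _ _ => abs_nonneg _, ?_⟩
  intro y hy
  rw [eval_eq, Finset.sum_mul]
  refine (Finset.abs_sum_le_sum_abs _ _).trans (Finset.sum_le_sum fun s hs => ?_)
  rw [abs_mul]
  refine mul_le_mul_of_nonneg_left ?_ (abs_nonneg _)
  have hd : ∏ i ∈ s.support, ‖y‖ ^ s i = ‖y‖ ^ s.degree := by
    rw [Finset.prod_pow_eq_pow_sum]; rfl
  calc |∏ i ∈ s.support, y i ^ s i| = ∏ i ∈ s.support, |y i| ^ s i := by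
        rw [Finset.abs_prod]; simp [abs_pow]
    _ ≤ ∏ i ∈ s.support, ‖y‖ ^ s i := by
        refine Finset.prod_le_prod (fun i _ => by positivity) fun i _ => ?_
        gcongr
        exact norm_le_pi_norm y i
    _ = ‖y‖ ^ s.degree := hd
    _ ≤ ‖y‖ ^ n := pow_le_pow_of_le_one (norm_nonneg _) hy (h s hs)

lemma hasFDerivAt_eval (P : MvPolynomial (Fin 2) ℝ) (y : Fin 2 → ℝ) :
    HasFDerivAt (fun y => eval y P)
      (∑ i, eval y (pderiv i P) • ContinuousLinearMap.proj (R := ℝ) (φ := fun _ : Fin 2 => ℝ) i) y := by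
  induction P using MvPolynomial.induction_on with
  | C a => simpa using hasFDerivAt_const a y
  | add p q hp hq =>
    simp only [map_add, add_smul, Finset.sum_add_distrib]
    exact hp.add hq
  | mul_X p j hp =>
    have h1 : HasFDerivAt (fun y : Fin 2 → ℝ => y j)
      (ContinuousLinearMap.proj (R := ℝ) (φ := fun _ : Fin 2 => ℝ) j) y :=
      (ContinuousLinearMap.proj (R := ℝ) (φ := fun _ : Fin 2 => ℝ) j).hasFDerivAt
    have := hp.mul h1
    simp only [map_mul, eval_X]
    refine this.congr_fderiv ?_
    ext v
    fin_cases j <;> simp [Derivation.leibniz, pderiv_X, Fin.sum_univ_two, Pi.single_apply] <;> ring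

/-- lower bound on the denominator -/
def LowB (D : ℕ) (Q : MvPolynomial (Fin 2) ℝ) : Prop :=
  ∃ c : ℝ, 0 < c ∧ ∀ᶠ y in 𝓝 (0 : Fin 2 → ℝ), c * ‖y‖ ^ D ≤ |eval y Q|

lemma LowB.pow {D : ℕ} {Q : MvPolynomial (Fin 2) ℝ} (h : LowB D Q) (m : ℕ) :
    LowB (D * m) (Q ^ m) := by
  obtain ⟨c, hc, h⟩ := h
  refine ⟨c ^ m, by positivity, h.mono fun y hy => ?_⟩
  rw [pow_mul, ← mul_pow, map_pow, abs_pow]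
  gcongr

lemma LowB.ne {D : ℕ} {Q : MvPolynomial (Fin 2) ℝ} (h : LowB D Q) :
    ∀ᶠ y in 𝓝 (0 : Fin 2 → ℝ), y ≠ 0 → eval y Q ≠ 0 := by
  obtain ⟨c, hc, h⟩ := h
  refine h.mono fun y hy h0 h1 => ?_
  rw [h1, abs_zero] at hy
  have := norm_pos_iff.2 h0
  have : 0 < c * ‖y‖ ^ D := by positivity
  linarith

lemma quot_zero {n : ℕ} {P : MvPolynomial (Fin 2) ℝ}
    (h : P ∈ idealOfVars (Fin 2) ℝ ^ n) (hn : 1 ≤ n) : eval (0 : Fin 2 → ℝ) P = 0 := by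
  obtain ⟨C, -, hC⟩ := ord_bound h
  have := hC 0 (by simp)
  rw [norm_zero, zero_pow (by omega), mul_zero] at this
  exact abs_eq_zero.1 (le_antisymm this (abs_nonneg _))

lemma quot_bound {N D : ℕ} {P Q : MvPolynomial (Fin 2) ℝ}
    (hP : P ∈ idealOfVars (Fin 2) ℝ ^ (N + D)) (hQ : LowB D Q) (hN : 1 ≤ N) :
    ∃ C : ℝ, 0 ≤ C ∧ ∀ᶠ y in 𝓝 (0 : Fin 2 → ℝ), |eval y P / eval y Q| ≤ C * ‖y‖ ^ N := by
  obtain ⟨C, hC0, hC⟩ := ord_bound hP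
  obtain ⟨c, hc, h⟩ := hQ
  refine ⟨C / c, by positivity, ?_⟩
  filter_upwards [h, Metric.closedBall_mem_nhds (0 : Fin 2 → ℝ) one_pos] with y hy hy1
  have hy1 : ‖y‖ ≤ 1 := by simpa using hy1
  rcases eq_or_ne y 0 with rfl | h0
  · rw [quot_zero hP (by omega)]; simp; positivity
  have hpos := norm_pos_iff.2 h0
  have hpos2 : 0 < c * ‖y‖ ^ D := by positivity
  rw [abs_div, div_le_iff₀ (hpos2.trans_le hy)]
  calc |eval y P| ≤ C * ‖y‖ ^ (N + D) := hC y hy1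
    _ = C / c * ‖y‖ ^ N * (c * ‖y‖ ^ D) := by rw [pow_add]; field_simp
    _ ≤ _ := by gcongr

lemma eval_cont (P : MvPolynomial (Fin 2) ℝ) : Continuous fun y => eval y P :=
  MvPolynomial.continuous_eval P

lemma flat_quot (k : ℕ) : ∀ (N D : ℕ) (P Q : MvPolynomial (Fin 2) ℝ), k + 1 ≤ N →
    P ∈ idealOfVars (Fin 2) ℝ ^ (N + D) → Q ∈ idealOfVars (Fin 2) ℝ ^ D → LowB D Q →
    ContDiffAt ℝ k (fun y => eval y P / eval y Q) 0 ∧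
      ∀ j ≤ k, iteratedFDeriv ℝ j (fun y => eval y P / eval y Q) 0 = 0 := by
  induction k with
  | zero =>
    intro N D P Q hN hP hQ hL
    constructor
    · rw [Nat.cast_zero, contDiffAt_zero]
      refine ⟨_, hL.ne, fun y hy => ContinuousAt.continuousWithinAt ?_⟩
      rcases eq_or_ne y 0 with rfl | h0
      · obtain ⟨C, hC0, hC⟩ := quot_bound hP hL (by omega)
        rw [ContinuousAt, quot_zero hP (by omega), zero_div]
        refine squeeze_zero_norm' hC ?_
        have : Continuous fun y : Fin 2 → ℝ => C * ‖y‖ ^ N := by fun_prop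
        have := this.tendsto 0
        rwa [norm_zero, zero_pow (by omega), mul_zero] at this
      · exact (eval_cont P).continuousAt.div (eval_cont Q).continuousAt (hy h0)
    · intro j hj
      obtain rfl : j = 0 := by omega
      ext v
      rw [iteratedFDeriv_zero_apply, quot_zero hP (by omega), zero_div]; rfl
  | succ k ih =>
    intro N D P Q hN hP hQ hL
    set R : Fin 2 → MvPolynomial (Fin 2) ℝ := fun i => pderiv i P * Q - P * pderiv i Q with hR
    have hRo : ∀ i, R i ∈ idealOfVars (Fin 2) ℝ ^ ((N - 1) + D * 2) := fun i =>
      Ideal.sub_mem _ (ord_mul (by omega) (ord_pderiv i hP) hQ)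
        (ord_mul (by omega) hP (ord_pderiv i hQ))
    have IH := fun i => ih (N - 1) (D * 2) (R i) (Q ^ 2) (by omega) (hRo i) (ord_pow 2 hQ)
      (hL.pow 2)
    let L : Fin 2 → (ℝ →L[ℝ] ((Fin 2 → ℝ) →L[ℝ] ℝ)) := fun i =>
      (ContinuousLinearMap.id ℝ ℝ).smulRight
        (ContinuousLinearMap.proj (R := ℝ) (φ := fun _ : Fin 2 => ℝ) i)
    let g' : (Fin 2 → ℝ) → ((Fin 2 → ℝ) →L[ℝ] ℝ) := fun y =>
      ∑ i, (L i ∘ fun y => eval y (R i) / eval y (Q ^ 2)) y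
    have hd : ∀ᶠ y in 𝓝 (0 : Fin 2 → ℝ),
        HasFDerivAt (fun y => eval y P / eval y Q) (g' y) y := by
      filter_upwards [hL.ne] with y hy
      rcases eq_or_ne y 0 with rfl | h0
      · have hg0 : g' 0 = 0 := by
          simp only [g', Function.comp]
          refine Finset.sum_eq_zero fun i _ => ?_
          rw [quot_zero (hRo i) (by omega)]; simp
        rw [hg0]
        obtain ⟨C, hC0, hC⟩ := quot_bound hP hL (by omega)
        rw [hasFDerivAt_iff_isLittleO_nhds_zero]
        have h1 : (fun y : Fin 2 → ℝ => eval y P / eval y Q) =O[𝓝 0] fun y => ‖y‖ ^ N := by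
          refine Asymptotics.IsBigO.of_bound C (hC.mono fun y hy => ?_)
          rw [Real.norm_eq_abs, norm_pow, norm_norm]; exact hy
        have h2 : (fun y : Fin 2 → ℝ => ‖y‖ ^ N) =o[𝓝 0] fun y => y :=
          (Asymptotics.isLittleO_norm_pow_id (by omega))
        have h3 := h1.trans_isLittleO h2
        simp only [zero_add, quot_zero hP (by omega : 1 ≤ N + D), zero_div, sub_zero,
          _root_.zero_apply]
        exact h3
      · have hq := hy h0
        have h1 := (hasFDerivAt_eval P y).mul
          ((hasDerivAt_inv hq).comp_hasFDerivAt y (hasFDerivAt_eval Q y))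
        simp only [div_eq_mul_inv]
        refine h1.congr_fderiv ?_
        ext v
        simp [g', L, R, Fin.sum_univ_two]
        field_simp
        ring
    have hg' : ContDiffAt ℝ k g' 0 :=
      ContDiffAt.sum fun i _ => (L i).contDiff.contDiffAt.comp 0 (IH i).1
    refine ⟨?_, ?_⟩
    · rw [Nat.cast_succ, contDiffAt_succ_iff_hasFDerivAt]
      exact ⟨g', ⟨_, hd, fun y hy => hy⟩, hg'⟩
    · intro j hj
      cases j with
      | zero =>
        ext v
        rw [iteratedFDeriv_zero_apply, quot_zero hP (by omega), zero_div]; rfl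
      | succ j =>
        rw [← norm_eq_zero, ← norm_iteratedFDeriv_fderiv, norm_eq_zero]
        have he : fderiv ℝ (fun y => eval y P / eval y Q) =ᶠ[𝓝 0] g' :=
          hd.mono fun y hy => hy.fderiv
        rw [(he.iteratedFDeriv ℝ j).eq_of_nhds]
        have hjk : j ≤ k := by omega
        have hjk' : ((j : ℕ) : WithTop ℕ∞) ≤ k := by exact_mod_cast hjk
        have hs := iteratedFDeriv_sum_apply (𝕜 := ℝ) (u := Finset.univ) (n := j) (x := 0)
          (f := fun i => L i ∘ fun y => eval y (R i) / eval y (Q ^ 2))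
          (fun i _ => ((L i).contDiff.contDiffAt.comp 0 (IH i).1).of_le hjk')
        refine hs.trans (Finset.sum_eq_zero fun i _ => ?_)
        rw [(L i).iteratedFDeriv_comp_left (IH i).1 hjk', (IH i).2 j hjk]
        ext; simp

lemma hom_eval_smul {n : ℕ} {h : MvPolynomial (Fin 2) ℝ} (hh : h.IsHomogeneous n)
    (t : ℝ) (y : Fin 2 → ℝ) : eval (t • y) h = t ^ n * eval y h := by
  rw [eval_eq, eval_eq, Finset.mul_sum]
  refine Finset.sum_congr rfl fun s hs => ?_
  have hd : ∏ i ∈ s.support, t ^ s i = t ^ n := by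
    rw [Finset.prod_pow_eq_pow_sum, hh.degree_eq_sum_deg_support hs]
  simp only [Pi.smul_apply, smul_eq_mul, mul_pow, Finset.prod_mul_distrib, hd]
  ring

lemma ord_sub_hom {n : ℕ} {P : MvPolynomial (Fin 2) ℝ}
    (h : P ∈ idealOfVars (Fin 2) ℝ ^ n) :
    P - homogeneousComponent n P ∈ idealOfVars (Fin 2) ℝ ^ (n + 1) := by
  rw [mem_pow_idealOfVars_iff'] at h ⊢
  intro x hx
  rw [coeff_sub, coeff_homogeneousComponent]
  split_ifs with h1
  · simp
  · rw [h x (by omega)]; simp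

lemma num_ord {d : ℕ} {p q : MvPolynomial (Fin 2) ℝ} {F : (Fin 2 → ℝ) → ℝ}
    (hF : Continuous F) (hF0 : F 0 = 0) (hpq : ∀ y, F y * eval y q = eval y p)
    (hq : q ∈ idealOfVars (Fin 2) ℝ ^ d) : p ∈ idealOfVars (Fin 2) ℝ ^ (d + 1) := by
  suffices H : ∀ e ≤ d + 1, p ∈ idealOfVars (Fin 2) ℝ ^ e from H _ le_rfl
  intro e
  induction e with
  | zero => intro _; simp
  | succ e ih =>
    intro he
    have hp := ih (by omega)
    have hr := ord_sub_hom hp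
    have hh : homogeneousComponent e p = 0 := by
      refine MvPolynomial.funext fun y => ?_
      rw [map_zero]
      obtain ⟨C, hC0, hC⟩ := ord_bound hq
      obtain ⟨C', hC0', hC'⟩ := ord_bound hr
      have hB : Continuous fun t : ℝ =>
          |F (t • y)| * (C * ‖y‖ ^ d) + C' * ‖y‖ ^ (e + 1) * t := by fun_prop
      have hB0 := (hB.tendsto 0).mono_left (nhdsWithin_le_nhds (s := Set.Ioi 0))
      simp only [zero_smul, hF0, abs_zero, zero_mul, mul_zero, add_zero] at hB0
      have hev : ∀ᶠ t : ℝ in 𝓝[>] 0, |eval y (homogeneousComponent e p)| ≤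
          |F (t • y)| * (C * ‖y‖ ^ d) + C' * ‖y‖ ^ (e + 1) * t := by
        have hs : ∀ᶠ t : ℝ in 𝓝[>] 0, ‖t • y‖ < 1 := by
          have : Continuous fun t : ℝ => ‖t • y‖ := by fun_prop
          exact nhdsWithin_le_nhds (this.continuousAt.eventually_lt continuousAt_const (by simp))
        have h1 : ∀ᶠ t : ℝ in 𝓝[>] 0, t < 1 := nhdsWithin_le_nhds (Iio_mem_nhds one_pos)
        filter_upwards [hs, h1, self_mem_nhdsWithin] with t hs h1 (h0 : 0 < t)
        have e1 := hC _ hs.le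
        have e2 := hC' _ hs.le
        rw [map_sub, hom_eval_smul (homogeneousComponent_isHomogeneous e p), ← hpq] at e2
        rw [norm_smul, Real.norm_of_nonneg h0.le, mul_pow] at e1 e2
        have hte : 0 < t ^ e := by positivity
        have htd : t ^ d ≤ t ^ e := pow_le_pow_of_le_one h0.le h1.le (by omega)
        rw [← mul_le_mul_iff_right₀ hte]
        calc t ^ e * |eval y (homogeneousComponent e p)|
            = |t ^ e * eval y (homogeneousComponent e p)| := by rw [abs_mul, abs_of_pos hte]
          _ ≤ |F (t • y) * eval (t • y) q| +
              |F (t • y) * eval (t • y) q - t ^ e * eval y (homogeneousComponent e p)| := by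
              have := abs_sub (F (t • y) * eval (t • y) q)
                (F (t • y) * eval (t • y) q - t ^ e * eval y (homogeneousComponent e p))
              rwa [sub_sub_cancel] at this
          _ ≤ |F (t • y)| * (C * (t ^ e * ‖y‖ ^ d)) + C' * (t ^ (e + 1) * ‖y‖ ^ (e + 1)) := by
              rw [abs_mul]
              gcongr
              exact e1.trans (by gcongr)
          _ = _ := by ring
      have := ge_of_tendsto hB0 hev
      exact abs_eq_zero.1 (le_antisymm this (abs_nonneg _))
    rwa [hh, sub_zero] at hr

lemma eval_shift (a y : Fin 2 → ℝ) (q : MvPolynomial (Fin 2) ℝ) :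
    eval y (shiftPoly a q) = eval (a + y) q := by
  rw [shiftPoly, ← coe_aeval_eq_eval, ← coe_aeval_eq_eval, RingHom.coe_coe, RingHom.coe_coe,
    aeval_bind₁]
  congr 2
  ext i
  simp

lemma locPosDef_lowB {q : MvPolynomial (Fin 2) ℝ} {a : Fin 2 → ℝ} (h : LocPosDef q a) :
    ∃ d, shiftPoly a q ∈ idealOfVars (Fin 2) ℝ ^ d ∧ LowB d (shiftPoly a q) := by
  obtain ⟨d, -, hlow, hpos⟩ := h
  have hq : shiftPoly a q ∈ idealOfVars (Fin 2) ℝ ^ d := by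
    rw [mem_pow_idealOfVars_iff']
    intro x hx
    have := congrArg (coeff x) (hlow _ hx)
    rwa [coeff_homogeneousComponent, if_pos rfl, coeff_zero] at this
  refine ⟨d, hq, ?_⟩
  have hr := ord_sub_hom hq
  have hhom := homogeneousComponent_isHomogeneous d (shiftPoly a q)
  set Q := shiftPoly a q
  set h := homogeneousComponent d Q
  obtain ⟨C, hC0, hC⟩ := ord_bound hr
  obtain ⟨z, hz, hmin⟩ := (isCompact_sphere (0 : Fin 2 → ℝ) 1).exists_isMinOn
    (NormedSpace.sphere_nonempty.2 zero_le_one) (eval_cont h).continuousOn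
  have hz0 : z ≠ 0 := by rintro rfl; simp at hz
  have hc := hpos z hz0
  have hlb : ∀ y : Fin 2 → ℝ, y ≠ 0 → eval z h * ‖y‖ ^ d ≤ eval y h := by
    intro y hy
    have hn := norm_pos_iff.2 hy
    have h1 : eval z h ≤ eval (‖y‖⁻¹ • y) h := hmin (by
      simp [norm_smul, hn.ne'])
    have h2 := hom_eval_smul hhom ‖y‖ (‖y‖⁻¹ • y)
    rw [smul_inv_smul₀ hn.ne'] at h2
    rw [h2, mul_comm]
    gcongr
  have hsmall : ∀ᶠ y in 𝓝 (0 : Fin 2 → ℝ), C * ‖y‖ < eval z h / 2 := by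
    have : Continuous fun y : Fin 2 → ℝ => C * ‖y‖ := by fun_prop
    exact this.continuousAt.eventually_lt continuousAt_const (by simp; exact hc)
  -- the value at the origin is handled by continuity
  have hle : ∀ᶠ y in 𝓝[≠] (0 : Fin 2 → ℝ), eval z h / 2 * ‖y‖ ^ d ≤ |eval y Q| := by
    filter_upwards [nhdsWithin_le_nhds hsmall, self_mem_nhdsWithin,
      nhdsWithin_le_nhds (Metric.closedBall_mem_nhds (0 : Fin 2 → ℝ) one_pos)] with y h1 h2 h3
    have h3 : ‖y‖ ≤ 1 := by simpa using h3
    have h4 := hC y h3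
    rw [map_sub, pow_succ] at h4
    have h5 := hlb y h2
    have h6 : 0 ≤ ‖y‖ ^ d := by positivity
    have h7 := (abs_le.1 h4).1
    have h8 := le_abs_self (eval y Q)
    nlinarith [mul_le_mul_of_nonneg_right h1.le h6]
  refine ⟨eval z h / 2, by positivity, ?_⟩
  have h0 : eval z h / 2 * ‖(0 : Fin 2 → ℝ)‖ ^ d ≤ |eval 0 Q| := by
    have c1 : Continuous fun y : Fin 2 → ℝ => eval z h / 2 * ‖y‖ ^ d := by fun_prop
    have c2 : Continuous fun y : Fin 2 → ℝ => |eval y Q| := (eval_cont Q).abs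
    exact le_of_tendsto_of_tendsto ((c1.tendsto 0).mono_left nhdsWithin_le_nhds)
      ((c2.tendsto 0).mono_left nhdsWithin_le_nhds) hle
  rw [eventually_nhdsWithin_iff] at hle
  filter_upwards [hle] with y hy
  rcases eq_or_ne y 0 with rfl | hy0
  · exact h0
  · exact hy hy0

lemma nonzero_lowB {Q : MvPolynomial (Fin 2) ℝ} (h : eval 0 Q ≠ 0) : LowB 0 Q := by
  have hp := abs_pos.2 h
  refine ⟨|eval 0 Q| / 2, by positivity, ?_⟩
  have := (eval_cont Q).abs.continuousAt (x := 0)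
  filter_upwards [continuousAt_const.eventually_lt this (half_lt_self hp)] with y hy
  simpa using hy.le

/-- STATEMENT 19: for a [1]-regulous function `f` and `k ≥ 1`, the power `f^m` is `k`-flat
for every `m ≥ 2k`. -/
theorem pow_of_oneRegulous_is_k_flat
    (k : ℕ) (hk : 1 ≤ k) (f : (Fin 2 → ℝ) → ℝ) (hf : OneRegulous f)
    (m : ℕ) (hm : 2 * k ≤ m) :
    ∀ a : Fin 2 → ℝ, f a = 0 →
      ContDiffAt ℝ k (fun x => f x ^ m) a ∧
      ∀ j ≤ k, iteratedFDeriv ℝ j (fun x => f x ^ m) a = 0 := by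
  intro a ha
  obtain ⟨hfc, p, q, -, -, hfin, hfpq, hloc⟩ := hf
  have hall : ∀ x, f x * eval x q = eval x p := by
    have hdense : Dense {x : Fin 2 → ℝ | eval x q = 0}ᶜ := hfin.countable.dense_compl ℝ
    have := Continuous.ext_on hdense (hfc.mul (eval_cont q)) (eval_cont p) (fun x hx => by
      simp only [Pi.mul_apply]
      rw [hfpq x hx, div_mul_cancel₀ _ hx])
    exact fun x => congrFun this x
  obtain ⟨d, hqo, hL⟩ : ∃ d, shiftPoly a q ∈ idealOfVars (Fin 2) ℝ ^ d ∧
      LowB d (shiftPoly a q) := by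
    by_cases h0 : eval a q = 0
    · exact locPosDef_lowB (hloc a h0)
    · exact ⟨0, by simp, nonzero_lowB (by rwa [eval_shift, add_zero])⟩
  have hpo : shiftPoly a p ∈ idealOfVars (Fin 2) ℝ ^ (d + 1) :=
    num_ord (F := fun y => f (a + y)) (by fun_prop) (by simpa using ha)
      (fun y => by rw [eval_shift, eval_shift]; exact hall _) hqo
  have key := flat_quot k m (d * m) (shiftPoly a p ^ m) (shiftPoly a q ^ m) (by omega)
    (ord_mono (by rw [add_mul]; omega) (ord_pow m hpo)) (ord_pow m hqo) (hL.pow m)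
  have heq : (fun y => eval y (shiftPoly a p ^ m) / eval y (shiftPoly a q ^ m)) =ᶠ[𝓝 0]
      fun y => f (y + a) ^ m := by
    filter_upwards [hL.ne] with y hy
    rcases eq_or_ne y 0 with rfl | h0
    · rw [quot_zero (ord_pow m hpo) (by rw [add_mul]; omega), zero_add, ha, zero_div,
        zero_pow (by omega)]
    · have hq := hy h0
      rw [map_pow, map_pow, ← div_pow, add_comm y a]
      congr 1
      rw [div_eq_iff hq, eval_shift, eval_shift]
      exact (hall _).symm
  constructor
  · have h1 := key.1.congr_of_eventuallyEq heq.symm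
    have h2 : ContDiffAt ℝ k (fun x : Fin 2 → ℝ => x - a) a := by fun_prop
    have h3 := ContDiffAt.comp (g := fun y => f (y + a) ^ m) a (by rwa [sub_self]) h2
    simpa [Function.comp_def] using h3
  · intro j hj
    have h1 := key.2 j hj
    rw [(heq.iteratedFDeriv ℝ j).eq_of_nhds] at h1
    rw [iteratedFDeriv_comp_add_right (f := fun x => f x ^ m), zero_add] at h1
    exact h1
end
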